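/- arXiv:1102.3543 — 8 statements merged into one kernel-verified Lean document; each statement's English description precedes it below -/
import Mathlib

section
/- The algebra of H_0-invariant polynomials in k[x_1,...,x_19] is not finitely generated as a k-algebra. Here H_0 acts on polynomials via its linear action on V = k^19: for h ∈ H_0 and f ∈ k[V], (h·f)(v) = f(h^{-1}·v), and a polynomial f is H_0-invariant if h·f = f for all h ∈ H_0. -/
open Matrix

noncomputable section

/-- The 15×4 matrix M(μ̄) from A'Campo-Neuen's counterexample. -/
def Mmat (k : Type*) [Field k] (μ : Fin 12 → k) : Matrix (Fin 15) (Fin 4) k :=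
  !![μ 1, μ 0, 0, 0;
     μ 2, μ 1, 0, 0;
     0, μ 2, 0, 0;
     μ 3, 0, μ 0, 0;
     μ 4, 0, μ 3, 0;
     0, 0, μ 4, 0;
     μ 5, 0, 0, μ 0;
     μ 6, 0, 0, μ 5;
     0, 0, 0, μ 6;
     μ 7, μ 0, 0, 0;
     μ 8, μ 7, 0, 0;
     μ 9, 0, μ 8, 0;
     μ 10, 0, μ 9, 0;
     μ 11, 0, 0, μ 10;
     0, 0, 0, μ 11]

/-- The 19×19 block matrix h(μ̄) = [[E₄, 0], [M(μ̄), E₁₅]]. -/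
def hmat (k : Type*) [Field k] (μ : Fin 12 → k) : Matrix (Fin 19) (Fin 19) k :=
  Matrix.reindex finSumFinEquiv finSumFinEquiv
    (Matrix.fromBlocks (1 : Matrix (Fin 4) (Fin 4) k) (0 : Matrix (Fin 4) (Fin 15) k)
      (Mmat k μ) (1 : Matrix (Fin 15) (Fin 15) k))



section sl2
variable {k V : Type*} [Field k] [CharZero k] [AddCommGroup V] [Module k V]

theorem sl2_H_D (D H : V →ₗ[k] V) (hHD : ∀ x, H (D x) = D (H x) + (2:k) • D x)
    (p : V) (l : k) (hp : H p = l • p) (j : ℕ) :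
    H ((D ^ j) p) = (l + 2 * j) • (D ^ j) p := by
  induction j with
  | zero => simp [hp]
  | succ j ih =>
    rw [pow_succ', Module.End.mul_apply, hHD, ih, map_smul, ← add_smul]
    push_cast; congr 1; ring

theorem sl2_H_E (E H : V →ₗ[k] V) (hHE : ∀ x, H (E x) = E (H x) - (2:k) • E x)
    (p : V) (l : k) (hp : H p = l • p) (j : ℕ) :
    H ((E ^ j) p) = (l - 2 * j) • (E ^ j) p := by
  induction j with
  | zero => simp [hp]
  | succ j ih =>
    rw [pow_succ', Module.End.mul_apply, hHE, ih, map_smul, ← sub_smul]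
    push_cast; congr 1; ring

theorem sl2_D_E (D E H : V →ₗ[k] V) (hDE : ∀ x, D (E x) = E (D x) + H x)
    (hHE : ∀ x, H (E x) = E (H x) - (2:k) • E x)
    (p : V) (l : k) (hp : H p = l • p) (j : ℕ) :
    D ((E ^ (j+1)) p) = (E ^ (j+1)) (D p) + (((j:k)+1) * (l - j)) • (E ^ j) p := by
  induction j with
  | zero => simp [hp, hDE]
  | succ j ih =>
    rw [pow_succ', Module.End.mul_apply, hDE, ih, sl2_H_E E H hHE p l hp, map_add, map_smul,
      Module.End.mul_apply, add_assoc, ← Module.End.mul_apply E (E ^ j), ← pow_succ',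
      ← add_smul]
    push_cast; congr 2; ring

theorem sl2_surj (D E H : V →ₗ[k] V) (hDE : ∀ x, D (E x) = E (D x) + H x)
    (hHE : ∀ x, H (E x) = E (H x) - (2:k) • E x)
    (hHD : ∀ x, H (D x) = D (H x) + (2:k) • D x)
    (p : V) (l : ℕ) (hl : 1 ≤ l) (hp : H p = (l:k) • p) (M : ℕ) (hM : (D ^ M) p = 0) :
    ∃ q, D q = p ∧ H q = ((l:k) - 2) • q := by
  have key : ∀ d j : ℕ, j + d = M →
      ∃ q, D q = (E ^ j) ((D ^ j) p) ∧ H q = ((l:k) - 2) • q := by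
    intro d
    induction d with
    | zero => intro j hj; obtain rfl : j = M := hj; exact ⟨0, by simp [hM], by simp⟩
    | succ d ih =>
      intro j hj
      obtain ⟨q', h1, h2⟩ := ih (j+1) (by omega)
      have hw := sl2_H_D D H hHD p l hp j
      have h3 := sl2_D_E D E H hDE hHE _ _ hw j
      have h4 := sl2_H_E E H hHE _ _ hw (j+1)
      have hc : (((j:k)+1) * ((l:k) + 2 * j - j)) ≠ 0 := by
        have : (((j:k)+1) * ((l:k) + 2 * j - j)) = (((j+1) * (l + j) : ℕ) : k) := by
          push_cast; ring
        rw [this]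
        exact_mod_cast (by positivity)
      refine ⟨(((j:k)+1) * ((l:k) + 2 * j - j))⁻¹ • ((E ^ (j+1)) ((D ^ j) p) - q'), ?_, ?_⟩
      · rw [map_smul, map_sub, h3, h1, pow_succ' D, Module.End.mul_apply, add_sub_cancel_left,
          smul_smul, inv_mul_cancel₀ hc, one_smul]
      · rw [map_smul, map_sub, h4, h2, smul_comm ((l:k) - 2), smul_sub ((l:k) - 2)]
        congr 3; push_cast; ring
  simpa using key M 0 (by simp)
end sl2

section chain
open MvPolynomial
variable (k : Type*) [Field k] [CharZero k]

abbrev DS : Derivation k (MvPolynomial (Fin 6) k) (MvPolynomial (Fin 6) k) :=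
  mkDerivation k ![0, 0, 0, X 0, X 1, X 2]
abbrev ES : Derivation k (MvPolynomial (Fin 6) k) (MvPolynomial (Fin 6) k) :=
  mkDerivation k ![X 3, X 4, X 5, 0, 0, 0]
abbrev HS : Derivation k (MvPolynomial (Fin 6) k) (MvPolynomial (Fin 6) k) :=
  mkDerivation k ![X 0, X 1, X 2, - X 3, - X 4, - X 5]

theorem DE_S (x) : DS k (ES k x) = ES k (DS k x) + HS k x := by
  have : ⁅DS k, ES k⁆ = HS k := by
    apply MvPolynomial.derivation_ext
    intro i
    rw [Derivation.commutator_apply]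
    fin_cases i <;> simp [mkDerivation_X]
  rw [← this, Derivation.commutator_apply]; ring

theorem HE_S (x) : HS k (ES k x) = ES k (HS k x) - (2:k) • ES k x := by
  have : ⁅HS k, ES k⁆ = (-2 : k) • ES k := by
    apply MvPolynomial.derivation_ext
    intro i
    rw [Derivation.commutator_apply]
    fin_cases i <;> simp [mkDerivation_X, two_smul] <;> ring
  have h := congrArg (fun d => d x) this
  simp only [Derivation.commutator_apply, Derivation.smul_apply] at h
  rw [sub_eq_iff_eq_add] at h
  rw [h]; module

theorem HD_S (x) : HS k (DS k x) = DS k (HS k x) + (2:k) • DS k x := by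
  have : ⁅HS k, DS k⁆ = (2 : k) • DS k := by
    apply MvPolynomial.derivation_ext
    intro i
    rw [Derivation.commutator_apply]
    fin_cases i <;> simp [mkDerivation_X, two_smul]
  have h := congrArg (fun d => d x) this
  simp only [Derivation.commutator_apply, Derivation.smul_apply] at h
  rw [sub_eq_iff_eq_add] at h
  rw [h]; module

/-- multiplier -/
def pS (n : ℕ) : MvPolynomial (Fin 6) k :=
  if n % 3 = 0 then X 0 else if n % 3 = 1 then X 1 * X 2 else X 0 * X 1 * X 2

/-- weight -/
def wS (n : ℕ) : k := if n % 3 = 0 then 0 else -1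

theorem DS_pS (n : ℕ) : DS k (pS k n) = 0 := by
  unfold pS; split_ifs <;> simp [mkDerivation_X]

theorem DS_pow_mul (n j : ℕ) (q) :
    (((DS k).toLinearMap) ^ j) (pS k n * q) = pS k n * (((DS k).toLinearMap) ^ j) q := by
  induction j with
  | zero => simp
  | succ j ih =>
    rw [pow_succ', Module.End.mul_apply, ih, Module.End.mul_apply]
    simp [Derivation.leibniz, DS_pS]

theorem chain_step (n : ℕ) (q : MvPolynomial (Fin 6) k) (h1 : HS k q = wS k n • q)
    (h2 : (((DS k).toLinearMap) ^ (n+1)) q = 0) :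
    ∃ q', (HS k q' = wS k (n+1) • q' ∧ (((DS k).toLinearMap) ^ (n+2)) q' = 0) ∧
      DS k q' = pS k n * q := by
  have hl : ∃ l : ℕ, 1 ≤ l ∧ HS k (pS k n * q) = (l:k) • (pS k n * q) ∧
      (l : k) - 2 = wS k (n+1) := by
    have h3 : n % 3 = 0 ∨ n % 3 = 1 ∨ n % 3 = 2 := by omega
    rcases h3 with h | h | h
    · refine ⟨1, le_rfl, ?_, ?_⟩
      · simp [h1, wS, pS, h, mkDerivation_X, mul_comm]
      · simp [wS, show (n+1) % 3 = 1 by omega]; norm_num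
    · refine ⟨1, le_rfl, ?_, ?_⟩
      · simp [h1, wS, pS, h, mkDerivation_X]; ring
      · simp [wS, show (n+1) % 3 = 2 by omega]; norm_num
    · refine ⟨2, by norm_num, ?_, ?_⟩
      · simp [h1, wS, pS, h, mkDerivation_X, two_smul]; ring
      · simp [wS, show (n+1) % 3 = 0 by omega]
  obtain ⟨l, hl, hH, hw⟩ := hl
  obtain ⟨q', e1, e2⟩ := sl2_surj (DS k).toLinearMap (ES k).toLinearMap (HS k).toLinearMap
    (DE_S k) (HE_S k) (HD_S k) (pS k n * q) l hl hH (n+1) (by rw [DS_pow_mul, h2, mul_zero])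
  refine ⟨q', ⟨?_, ?_⟩, e1⟩
  · rw [← hw]; exact e2
  · rw [pow_succ, Module.End.mul_apply, e1, DS_pow_mul, h2, mul_zero]

theorem chain_exists : ∃ Q : ℕ → MvPolynomial (Fin 6) k, Q 0 = 1 ∧
    ∀ n, DS k (Q (n+1)) = pS k n * Q n := by
  choose! f hf1 hf2 using chain_step k
  let Q : ℕ → MvPolynomial (Fin 6) k := fun n => Nat.rec 1 f n
  have hQ : ∀ n, HS k (Q n) = wS k n • (Q n) ∧ (((DS k).toLinearMap) ^ (n+1)) (Q n) = 0 := by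
    intro n
    induction n with
    | zero => simp [Q, wS]
    | succ n ih => exact hf1 n _ ih.1 ih.2
  exact ⟨Q, rfl, fun n => hf2 n _ (hQ n).1 (hQ n).2⟩
end chain

set_option linter.unusedSectionVars false
set_option linter.unusedSimpArgs false

section seven
open MvPolynomial
variable (k : Type*) [Field k] [CharZero k]

theorem derivation_aeval {σ A : Type*} [CommRing A] [Algebra k A] (Δ : Derivation k A A)
    (c : σ → A) (d : σ → MvPolynomial σ k) (h : ∀ i, Δ (c i) = aeval c (d i))
    (g : MvPolynomial σ k) : Δ (aeval c g) = aeval c (mkDerivation k d g) := by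
  induction g using MvPolynomial.induction_on with
  | C a => simp
  | add p q hp hq => simp [hp, hq]
  | mul_X p i hp => simp [hp, h, mkDerivation_X]

/-- Roberts' derivation -/
abbrev d7 : Fin 7 → MvPolynomial (Fin 7) k :=
  ![0, 0, 0, X 0 ^ 3, X 1 ^ 3, X 2 ^ 3, -(X 0 * X 1 * X 2) ^ 2]

abbrev D7 : Derivation k (MvPolynomial (Fin 7) k) (MvPolynomial (Fin 7) k) :=
  mkDerivation k (d7 k)

/-- curve along the flow -/
def cU {R : Type*} [CommRing R] (U : Fin 7 → R) : Fin 7 → Polynomial R :=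
  ![.C (U 0), .C (U 1), .C (U 2), .C (U 3) + .X * .C (U 0 ^ 3), .C (U 4) + .X * .C (U 1 ^ 3),
    .C (U 5) + .X * .C (U 2 ^ 3), .C (U 6) - .X * .C ((U 0 * U 1 * U 2) ^ 2)]

theorem deriv_cU {R : Type*} [CommRing R] [Algebra k R] (U : Fin 7 → R)
    (g : MvPolynomial (Fin 7) k) :
    Polynomial.derivative (aeval (cU U) g) = aeval (cU U) (D7 k g) := by
  have := derivation_aeval k ((Polynomial.derivative' (R := R)).restrictScalars k) (cU U) (d7 k)
    (by intro i; fin_cases i <;> simp [cU, Polynomial.derivative'] <;>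
      simp [← Polynomial.C_pow, ← Polynomial.C_mul, -map_pow, -map_mul]) g
  exact this

theorem eval_cU {R : Type*} [CommRing R] [Algebra k R] (U : Fin 7 → R) (τ : R)
    (g : MvPolynomial (Fin 7) k) :
    Polynomial.eval τ (aeval (cU U) g) = aeval (fun i => Polynomial.eval τ (cU U i)) g := by
  have : (((Polynomial.aeval (R := R) τ).restrictScalars k).comp (aeval (cU U))) =
     aeval (fun i => Polynomial.eval τ (cU U i)) := by
    apply MvPolynomial.algHom_ext
    intro i
    simp [Polynomial.aeval_def, Polynomial.eval₂_eq_eval_map]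
  have h := DFunLike.congr_fun this g
  simpa [Polynomial.aeval_def, Polynomial.eval₂_eq_eval_map] using h

theorem eval_zero_cU {R : Type*} [CommRing R] (U : Fin 7 → R) :
    (fun i => Polynomial.eval 0 (cU U i)) = U := by
  funext i; fin_cases i <;> simp [cU]

theorem flow_inv {R : Type*} [CommRing R] [IsDomain R] [CharZero R] [Algebra k R] (U : Fin 7 → R)
    (τ : R) (g : MvPolynomial (Fin 7) k) (hg : D7 k g = 0) :
    aeval (fun i => Polynomial.eval τ (cU U i)) g = aeval U g := by
  have h := deriv_cU k U g
  rw [hg, map_zero] at h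
  have h2 := Polynomial.eq_C_of_derivative_eq_zero h
  have h3 := eval_cU k U 0 g
  rw [eval_zero_cU] at h3
  rw [← eval_cU, ← h3, h2]; simp

theorem D7_of_flow (g : MvPolynomial (Fin 7) k)
    (h : ∀ (p : Fin 7 → k) (τ : k), eval (fun i => Polynomial.eval τ (cU p i)) g = eval p g) :
    D7 k g = 0 := by
  have key : aeval (cU (X : Fin 7 → MvPolynomial (Fin 7) k)) g = Polynomial.C g := by
    apply Polynomial.eq_of_infinite_eval_eq
    apply Set.infinite_of_injective_forall_mem (f := fun τ : k => (C τ : MvPolynomial (Fin 7) k))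
      (C_injective _ _)
    intro τ
    simp only [Set.mem_ofPred_eq, Polynomial.eval_C]
    rw [eval_cU]
    apply MvPolynomial.funext
    intro p
    rw [← h p τ, ← MvPolynomial.coe_aeval_eq_eval, ← MvPolynomial.coe_aeval_eq_eval]
    simp only [RingHom.coe_coe]
    rw [← AlgHom.comp_apply, MvPolynomial.comp_aeval]
    refine congrArg (fun c => aeval c g) ?_
    funext i
    fin_cases i <;> simp [cU]
  have h2 := deriv_cU k (X : Fin 7 → MvPolynomial (Fin 7) k) g
  rw [key, Polynomial.derivative_C] at h2
  have h3 := eval_cU k (X : Fin 7 → MvPolynomial (Fin 7) k) 0 (D7 k g)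
  rw [← h2, eval_zero_cU] at h3
  simpa using h3.symm

theorem D7_eq (g : MvPolynomial (Fin 7) k) : D7 k g =
    monomial (Finsupp.single 0 3) 1 * pderiv 3 g + monomial (Finsupp.single 1 3) 1 * pderiv 4 g +
    monomial (Finsupp.single 2 3) 1 * pderiv 5 g -
    monomial (Finsupp.single 0 2 + Finsupp.single 1 2 + Finsupp.single 2 2) 1 * pderiv 6 g := by
  have : D7 k = (X 0 ^ 3 : MvPolynomial (Fin 7) k) • pderiv 3 + 
    (X 1 ^ 3 : MvPolynomial (Fin 7) k) • pderiv 4 + (X 2 ^ 3 : MvPolynomial (Fin 7) k) • pderiv 5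
    + (-(X 0 * X 1 * X 2) ^ 2 : MvPolynomial (Fin 7) k) • pderiv 6 := by
    apply MvPolynomial.derivation_ext
    intro i
    fin_cases i <;> simp [mkDerivation_X, pderiv_X, Pi.single_apply]
  have e : (monomial (Finsupp.single 0 2 + Finsupp.single 1 2 + Finsupp.single 2 2) 1 :
      MvPolynomial (Fin 7) k) = (X 0 * X 1 * X 2) ^ 2 := by
    simp only [mul_pow, X_pow_eq_monomial, monomial_mul, one_mul]
  rw [this, e]
  simp only [← X_pow_eq_monomial]
  simp
  ring

theorem claimA (g : MvPolynomial (Fin 7) k) (hg : D7 k g = 0) (n : ℕ) :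
    coeff (Finsupp.single 6 (n+1)) g = 0 := by
  rw [D7_eq] at hg
  have h := congrArg (coeff (Finsupp.single 0 2 + Finsupp.single 1 2 + Finsupp.single 2 2 +
    Finsupp.single 6 n)) hg
  simp only [coeff_sub, coeff_add, coeff_monomial_mul, coeff_zero] at h
  rw [coeff_monomial_mul', coeff_monomial_mul', coeff_monomial_mul', if_neg, if_neg, if_neg] at h
  · rw [coeff_pderiv] at h
    simp at h
    rcases h with h | h
    · rw [Finsupp.single_add]; exact h
    · exact absurd h (by exact_mod_cast Nat.succ_ne_zero n)
  · intro hle; have := hle 2; simp at this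
  · intro hle; have := hle 1; simp at this
  · intro hle; have := hle 0; simp at this

theorem coeff_special (g : MvPolynomial (Fin 7) k) (n : ℕ) :
    (aeval (![0,0,0,0,0,0,Polynomial.X] : Fin 7 → Polynomial k) g).coeff n =
      coeff (Finsupp.single 6 n) g := by
  induction g using MvPolynomial.induction_on' with
  | add p q hp hq => simp [hp, hq]
  | monomial m a =>
    rw [aeval_monomial, Finsupp.prod_fintype _ _ (by simp), coeff_monomial]
    simp only [Fin.prod_univ_seven, Polynomial.algebraMap_eq, Polynomial.coeff_C_mul]
    by_cases h : m = Finsupp.single 6 (m 6)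
    · rw [h]
      simp [Polynomial.coeff_X_pow, eq_comm, (Finsupp.single_injective (M := ℕ) (6 : Fin 7)).eq_iff]
    · rw [if_neg (fun h' => h (by rw [h']; simp))]
      have : ∃ i : Fin 7, i ≠ 6 ∧ m i ≠ 0 := by
        by_contra! hc
        apply h
        ext i
        by_cases hi : i = 6
        · simp [hi]
        · rw [hc i hi, Finsupp.single_apply, if_neg (Ne.symm hi)]
      obtain ⟨i, hi, hm⟩ := this
      fin_cases i <;> simp_all

/-- main building block of the invariants -/
theorem seq7 : ∃ a : ℕ → MvPolynomial (Fin 7) k, a 0 = X 0 ∧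
    (∀ n, D7 k (a (n+1)) = (X 0 * X 1 * X 2) ^ 2 * a n) ∧
    ∀ n, ∃ b : MvPolynomial (Fin 6) k, a n = aeval ![X 0, X 1, X 2, X 3, X 4, X 5] b := by
  obtain ⟨Q, hQ0, hQ⟩ := chain_exists k
  let m : ℕ → MvPolynomial (Fin 6) k := fun n =>
    if n % 3 = 0 then X 0 else if n % 3 = 1 then (X 1 * X 2)^2 else X 0 ^ 2 * X 1 * X 2
  let i6 : MvPolynomial (Fin 6) k →ₐ[k] MvPolynomial (Fin 7) k :=
    aeval ![X 0, X 1, X 2, X 3, X 4, X 5]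
  let J : MvPolynomial (Fin 6) k →ₐ[k] MvPolynomial (Fin 6) k :=
    aeval ![X 0 ^ 3, X 1 ^ 3, X 2 ^ 3, X 3, X 4, X 5]
  let v : Fin 6 → MvPolynomial (Fin 7) k := ![X 0 ^ 3, X 1 ^ 3, X 2 ^ 3, X 3, X 4, X 5]
  have hJ : ∀ q, i6 (J q) = aeval v q := by
    intro q
    have : i6.comp J = aeval v := by
      apply MvPolynomial.algHom_ext
      intro i
      fin_cases i <;> simp [i6, J, v]
    exact DFunLike.congr_fun this q
  have hD : ∀ q, D7 k (aeval v q) = aeval v (DS k q) := by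
    intro q
    apply derivation_aeval
    intro i
    fin_cases i <;> simp [v, mkDerivation_X, d7]
  have hm : ∀ n, D7 k (i6 (m n)) = 0 := by
    intro n
    simp only [m]; split_ifs <;> simp [i6, mkDerivation_X, d7]
  refine ⟨fun n => i6 (m n * J (Q n)), ?_, ?_, fun n => ⟨_, rfl⟩⟩
  · simp [hQ0, m, i6]
  · intro n
    simp only [map_mul, hJ]
    rw [Derivation.leibniz, hm, hD, hQ]
    simp only [map_mul, smul_zero, mul_zero, add_zero, smul_eq_mul, ← mul_assoc]
    refine congrArg (· * aeval v (Q n)) ?_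
    have h3 : n % 3 = 0 ∨ n % 3 = 1 ∨ n % 3 = 2 := by omega
    rcases h3 with h | h | h
    · simp [m, h, show (n+1) % 3 = 1 by omega, i6, pS, v]; ring
    · simp [m, h, show (n+1) % 3 = 2 by omega, i6, pS, v]; ring
    · simp [m, h, show (n+1) % 3 = 0 by omega, i6, pS, v]; ring

theorem claimB (n : ℕ) : ∃ F : MvPolynomial (Fin 7) k, D7 k F = 0 ∧
    ((aeval (![.X, 0, 0, 0, 0, 0, .C .X] : Fin 7 → Polynomial (Polynomial k)) F).coeff 1).coeff n
      ≠ 0 := by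
  obtain ⟨a, ha0, haD, hab⟩ := seq7 k
  refine ⟨∑ i ∈ Finset.range (n+1), C (((n-i).factorial : k)⁻¹) * X 6 ^ (n-i) * a i, ?_, ?_⟩
  · have : ∀ N, N ≤ n → D7 k (∑ i ∈ Finset.range (N+1),
        C (((n-i).factorial : k)⁻¹) * X 6 ^ (n-i) * a i) =
        - (if N = n then 0 else C (((n-N-1).factorial : k)⁻¹) * X 6 ^ (n-N-1) *
          ((X 0 * X 1 * X 2)^2 * a N)) := by
      have hstep : ∀ i, i < n → D7 k (C (((n-i).factorial : k)⁻¹) * X 6 ^ (n-i)) =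
          - (C (((n-i-1).factorial : k)⁻¹) * X 6 ^ (n-i-1) * (X 0 * X 1 * X 2)^2) := by
        intro i hi
        obtain ⟨r, hr⟩ : ∃ r, n - i = r + 1 := ⟨n-i-1, by omega⟩
        rw [hr]
        have : ((r+1).factorial : k)⁻¹ * ((r:k)+1) = (r.factorial : k)⁻¹ := by
          have h1 : (r.factorial : k) ≠ 0 := by exact_mod_cast r.factorial_ne_zero
          have h2 : (r:k)+1 ≠ 0 := by exact_mod_cast r.succ_ne_zero
          rw [Nat.factorial_succ]; push_cast; field_simp
        simp only [Nat.add_sub_cancel, ← this]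
        simp [Derivation.leibniz_pow, mkDerivation_X, d7]
        ring
      intro N
      induction N with
      | zero =>
        intro _
        have hx : D7 k (a 0) = 0 := by simp [ha0, mkDerivation_X, d7]
        rcases Nat.eq_zero_or_pos n with h | h
        · subst h; simp [hx]
        · rw [if_neg (by omega), Finset.sum_range_one, Derivation.leibniz, hx, hstep 0 h]
          simp; ring
      | succ N ih =>
        intro hN
        rw [Finset.sum_range_succ, map_add, ih (by omega), if_neg (by omega), Derivation.leibniz,
          haD]
        split_ifs with h
        · subst h; simp
        · rw [hstep (N+1) (by omega)]
          simp only [Nat.sub_sub, smul_eq_mul]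
          ring
    rw [this n le_rfl, if_pos rfl, neg_zero]
  · have hw : ∀ i, ∃ w : k, ((aeval (![.X, 0, 0, 0, 0, 0, .C .X] : Fin 7 → Polynomial (Polynomial k))
        (a i)).coeff 1) = Polynomial.C w := by
      intro i
      obtain ⟨b, hb⟩ := hab i
      let ψ : MvPolynomial (Fin 6) k →ₐ[k] Polynomial k := aeval ![.X, 0, 0, 0, 0, 0]
      have : (aeval (![.X, 0, 0, 0, 0, 0, .C .X] : Fin 7 → Polynomial (Polynomial k))).comp
          (aeval ![X 0, X 1, X 2, X 3, X 4, X 5]) =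
          (Polynomial.mapAlgHom (Algebra.ofId k (Polynomial k))).comp ψ := by
        apply MvPolynomial.algHom_ext
        intro i
        fin_cases i <;> simp [ψ]
      have h := DFunLike.congr_fun this b
      simp only [AlgHom.comp_apply] at h
      rw [hb, h]
      refine ⟨(ψ b).coeff 1, ?_⟩
      simp [Polynomial.coeff_map, Algebra.ofId_apply]
    choose w hw using hw
    have hw0 : w 0 = 1 := by
      have := hw 0
      rw [ha0] at this
      simp at this
      exact (Polynomial.C_injective (by simpa using this)).symm
    have hterm : ∀ i, ((aeval (![.X, 0, 0, 0, 0, 0, .C .X] : Fin 7 → Polynomial (Polynomial k))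
        (C (((n-i).factorial : k)⁻¹) * X 6 ^ (n-i) * a i)).coeff 1).coeff n =
        if n = n - i then ((n-i).factorial : k)⁻¹ * w i else 0 := by
      intro i
      have e : (aeval (![.X, 0, 0, 0, 0, 0, .C .X] : Fin 7 → Polynomial (Polynomial k))
        (C (((n-i).factorial : k)⁻¹) * X 6 ^ (n-i))) =
          Polynomial.C (Polynomial.C (((n-i).factorial : k)⁻¹) * Polynomial.X ^ (n-i)) := by
        rw [map_mul, map_pow, aeval_X, algHom_C]
        simp [Polynomial.algebraMap_apply]
      rw [map_mul, e, Polynomial.coeff_C_mul, hw, Polynomial.coeff_mul_C, Polynomial.coeff_C_mul,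
        Polynomial.coeff_X_pow]
      split_ifs <;> simp
    rw [map_sum, Polynomial.finsetSum_coeff, Polynomial.finsetSum_coeff,
      Finset.sum_eq_single 0]
    · rw [hterm]; simp [hw0, Nat.factorial_ne_zero]
    · intro i hi h0
      rw [hterm, if_neg]
      simp at hi; omega
    · simp
end seven

section nineteen
open MvPolynomial
variable (k : Type*) [Field k] [CharZero k]

theorem Mmat_neg (μ : Fin 12 → k) : Mmat k (-μ) = - Mmat k μ := by
  ext i j
  fin_cases i <;> fin_cases j <;> simp [Mmat]

theorem hmat_inv (μ : Fin 12 → k) : (hmat k μ)⁻¹ = hmat k (-μ) := by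
  apply Matrix.inv_eq_right_inv
  unfold hmat
  rw [Matrix.reindex_apply, Matrix.reindex_apply, Matrix.submatrix_mul_equiv,
    Matrix.fromBlocks_multiply, Mmat_neg]
  simp

theorem hmat_entry (ν : Fin 12 → k) (a b : Fin 4 ⊕ Fin 15) :
    hmat k ν (finSumFinEquiv a) (finSumFinEquiv b) =
      Matrix.fromBlocks (1 : Matrix (Fin 4) (Fin 4) k) (0 : Matrix (Fin 4) (Fin 15) k)
      (Mmat k ν) (1 : Matrix (Fin 15) (Fin 15) k) a b := by
  exact congrArg₂ (Matrix.fromBlocks (1 : Matrix (Fin 4) (Fin 4) k) (0 : Matrix (Fin 4) (Fin 15) k)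
      (Mmat k ν) (1 : Matrix (Fin 15) (Fin 15) k)) (finSumFinEquiv.symm_apply_apply a)
      (finSumFinEquiv.symm_apply_apply b)

theorem hmat11 (ν : Fin 12 → k) (a b : Fin 4) :
    hmat k ν (Fin.castAdd 15 a) (Fin.castAdd 15 b) = (1 : Matrix (Fin 4) (Fin 4) k) a b :=
  hmat_entry k ν (.inl a) (.inl b)

theorem hmat12 (ν : Fin 12 → k) (a : Fin 4) (b : Fin 15) :
    hmat k ν (Fin.castAdd 15 a) (Fin.natAdd 4 b) = 0 :=
  hmat_entry k ν (.inl a) (.inr b)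

theorem hmat21 (ν : Fin 12 → k) (a : Fin 15) (b : Fin 4) :
    hmat k ν (Fin.natAdd 4 a) (Fin.castAdd 15 b) = Mmat k ν a b :=
  hmat_entry k ν (.inr a) (.inl b)

theorem hmat22 (ν : Fin 12 → k) (a b : Fin 15) :
    hmat k ν (Fin.natAdd 4 a) (Fin.natAdd 4 b) = (1 : Matrix (Fin 15) (Fin 15) k) a b :=
  hmat_entry k ν (.inr a) (.inr b)

/-- the substitution -/
def sub19 (μ : Fin 12 → k) : Fin 19 → MvPolynomial (Fin 19) k :=
  fun i : Fin 19 => ∑ j : Fin 19, C ((hmat k μ)⁻¹ i j) * X j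

theorem sub19_castAdd (μ : Fin 12 → k) (i : Fin 4) :
    sub19 k μ (Fin.castAdd 15 i) = X (Fin.castAdd 15 i) := by
  unfold sub19
  rw [hmat_inv]
  refine (Fin.sum_univ_add (a := 4) (b := 15) _).trans ?_
  simp only [hmat11, hmat12]
  simp [Matrix.one_apply]

theorem sub19_natAdd (μ : Fin 12 → k) (i : Fin 15) :
    sub19 k μ (Fin.natAdd 4 i) = X (Fin.natAdd 4 i) -
      ∑ j : Fin 4, C (Mmat k μ i j) * X (Fin.castAdd 15 j) := by
  unfold sub19
  rw [hmat_inv]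
  refine (Fin.sum_univ_add (a := 4) (b := 15) _).trans ?_
  simp only [hmat21, hmat22, Mmat_neg]
  simp [Matrix.one_apply]
  ring

theorem sub19_eq (μ : Fin 12 → k) : sub19 k μ =
    ![X 0, X 1, X 2, X 3,
      X 4 - (C (μ 1) * X 0 + C (μ 0) * X 1),
      X 5 - (C (μ 2) * X 0 + C (μ 1) * X 1),
      X 6 - (C (μ 2) * X 1),
      X 7 - (C (μ 3) * X 0 + C (μ 0) * X 2),
      X 8 - (C (μ 4) * X 0 + C (μ 3) * X 2),
      X 9 - (C (μ 4) * X 2),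
      X 10 - (C (μ 5) * X 0 + C (μ 0) * X 3),
      X 11 - (C (μ 6) * X 0 + C (μ 5) * X 3),
      X 12 - (C (μ 6) * X 3),
      X 13 - (C (μ 7) * X 0 + C (μ 0) * X 1),
      X 14 - (C (μ 8) * X 0 + C (μ 7) * X 1),
      X 15 - (C (μ 9) * X 0 + C (μ 8) * X 2),
      X 16 - (C (μ 10) * X 0 + C (μ 9) * X 2),
      X 17 - (C (μ 11) * X 0 + C (μ 10) * X 3),
      X 18 - (C (μ 11) * X 3)] := by
  funext i
  refine Fin.addCases (m := 4) (n := 15) (fun j => ?_) (fun j => ?_) i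
  · rw [sub19_castAdd]; fin_cases j <;> rfl
  · rw [sub19_natAdd, Fin.sum_univ_four]
    fin_cases j <;> simp [Mmat]

/-- the slice -/
def iota19 : Fin 19 → MvPolynomial (Fin 7) k :=
  ![1, X 0, X 1, X 2, 0, 0, X 3, 0, 0, X 4, 0, 0, X 5, 0, 0, 0, 0, 0, X 6]

theorem eval_aeval' {σ ρ : Type*} (c : σ → MvPolynomial ρ k) (f : MvPolynomial σ k) (p : ρ → k) :
    eval p (aeval c f) = eval (fun i => eval p (c i)) f := by
  induction f using MvPolynomial.induction_on with
  | C a => simp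
  | add p q hp hq => simp only [map_add, hp, hq]
  | mul_X p i hp => simp only [map_mul, hp, aeval_X, eval_X]

theorem D7_slice (f : MvPolynomial (Fin 19) k) (hf : ∀ μ, aeval (sub19 k μ) f = f) :
    D7 k (aeval (iota19 k) f) = 0 := by
  apply D7_of_flow
  intro p τ
  rw [eval_aeval', eval_aeval']
  let x := p 0
  let y := p 1
  let z := p 2
  let μ : Fin 12 → k := ![-τ, τ*x, -τ*x^2, τ*y, -τ*y^2, τ*z, -τ*z^2, τ*x, -τ*x^2, τ*x^2*y,
    -τ*x^2*y^2, τ*x^2*y^2*z]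
  conv_rhs => rw [← hf μ]
  rw [eval_aeval']
  refine congrArg (fun c => eval c f) ?_
  rw [sub19_eq]
  funext i
  fin_cases i <;> simp [iota19, cU, μ, x, y, z] <;> ring

/-- The evaluation at `(1, ε, 0, …, 0, v)`. -/
def phi19 : MvPolynomial (Fin 19) k →ₐ[k] Polynomial (Polynomial k) :=
  aeval ![1, .X, 0, 0, 0, 0, 0, 0, 0, 0, 0, 0, 0, 0, 0, 0, 0, 0, .C .X]

theorem phi_coeff_zero (f : MvPolynomial (Fin 19) k) (hf : ∀ μ, aeval (sub19 k μ) f = f) :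
    ∃ a : k, (phi19 k f).coeff 0 = Polynomial.C a := by
  have h1 : (phi19 k f).coeff 0 =
      aeval (![0,0,0,0,0,0,Polynomial.X] : Fin 7 → Polynomial k) (aeval (iota19 k) f) := by
    have : ((Polynomial.aeval (R := Polynomial k) (0 : Polynomial k)).restrictScalars k).comp
        (phi19 k) =
        (aeval (![0,0,0,0,0,0,Polynomial.X] : Fin 7 → Polynomial k)).comp (aeval (iota19 k)) := by
      apply MvPolynomial.algHom_ext
      intro i
      fin_cases i <;> simp [phi19, iota19]
    have h := DFunLike.congr_fun this f
    simp only [AlgHom.comp_apply] at h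
    rw [← h, Polynomial.coeff_zero_eq_aeval_zero]
    rfl
  refine ⟨((phi19 k f).coeff 0).coeff 0, ?_⟩
  ext n
  rcases n with _ | n
  · simp
  · rw [h1, coeff_special, claimA k _ (D7_slice k f hf), Polynomial.coeff_C]
    simp

/-- the basic semi-invariants -/
def U19 : Fin 7 → MvPolynomial (Fin 19) k :=
  ![X 1, X 2, X 3,
    X 1 ^ 2 * X 4 - X 0 * X 1 * X 5 + X 0 ^ 2 * X 6,
    X 2 ^ 2 * X 7 - X 0 * X 2 * X 8 + X 0 ^ 2 * X 9,
    X 3 ^ 2 * X 10 - X 0 * X 3 * X 11 + X 0 ^ 2 * X 12,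
    X 0 ^ 5 * X 18 - X 0 ^ 4 * X 3 * X 17 + X 0 ^ 3 * X 3 ^ 2 * X 16
      - X 0 ^ 2 * X 2 * X 3 ^ 2 * X 15 + X 0 * X 2 ^ 2 * X 3 ^ 2 * X 14
      - X 1 * X 2 ^ 2 * X 3 ^ 2 * X 13]

theorem U19_inv (F : MvPolynomial (Fin 7) k) (hF : D7 k F = 0) (μ : Fin 12 → k) :
    aeval (sub19 k μ) (aeval (U19 k) F) = aeval (U19 k) F := by
  conv_rhs => rw [← flow_inv k (U19 k) (C (-μ 0)) F hF]
  rw [← AlgHom.comp_apply, MvPolynomial.comp_aeval]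
  refine congrArg (fun c => aeval c F) ?_
  rw [sub19_eq]
  funext i
  fin_cases i <;> simp [U19, cU] <;> ring

theorem phi_U (F : MvPolynomial (Fin 7) k) : phi19 k (aeval (U19 k) F) =
    aeval (![.X, 0, 0, 0, 0, 0, .C .X] : Fin 7 → Polynomial (Polynomial k)) F := by
  unfold phi19
  rw [← AlgHom.comp_apply, MvPolynomial.comp_aeval]
  refine congrArg (fun c => aeval c F) ?_
  funext i
  fin_cases i <;> simp [U19]

theorem not_fg_aux : ¬ ∃ s : Finset (MvPolynomial (Fin 19) k),
      (Algebra.adjoin k (s : Set (MvPolynomial (Fin 19) k)) :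
          Set (MvPolynomial (Fin 19) k)) =
        {f : MvPolynomial (Fin 19) k | ∀ μ : Fin 12 → k, aeval (sub19 k μ) f = f} := by
  rintro ⟨s, hs⟩
  let d := s.sup (fun f => ((phi19 k f).coeff 1).natDegree)
  have key : ∀ f ∈ Algebra.adjoin k (s : Set (MvPolynomial (Fin 19) k)),
      (∃ a : k, (phi19 k f).coeff 0 = Polynomial.C a) ∧ ((phi19 k f).coeff 1).natDegree ≤ d := by
    intro f hf
    induction hf using Algebra.adjoin_induction with
    | mem f hf =>
      refine ⟨phi_coeff_zero k f ?_, Finset.le_sup (f := fun f => ((phi19 k f).coeff 1).natDegree) hf⟩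
      have : f ∈ (Algebra.adjoin k (s : Set (MvPolynomial (Fin 19) k)) :
          Set (MvPolynomial (Fin 19) k)) := Algebra.subset_adjoin hf
      rw [hs] at this
      exact this
    | algebraMap r =>
      rw [AlgHom.commutes, Polynomial.algebraMap_apply]
      exact ⟨⟨r, by simp⟩, by simp [Polynomial.coeff_C]⟩
    | add f g _ _ hf hg =>
      obtain ⟨⟨a, ha⟩, hf⟩ := hf
      obtain ⟨⟨b, hb⟩, hg⟩ := hg
      refine ⟨⟨a + b, by simp [ha, hb]⟩, ?_⟩
      rw [map_add, Polynomial.coeff_add]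
      exact Polynomial.natDegree_add_le_of_degree_le hf hg
    | mul f g _ _ hf hg =>
      obtain ⟨⟨a, ha⟩, hf⟩ := hf
      obtain ⟨⟨b, hb⟩, hg⟩ := hg
      refine ⟨⟨a * b, by simp [ha, hb, Polynomial.mul_coeff_zero]⟩, ?_⟩
      rw [map_mul, Polynomial.mul_coeff_one, ha, hb]
      exact Polynomial.natDegree_add_le_of_degree_le
        ((Polynomial.natDegree_C_mul_le _ _).trans hg)
        ((Polynomial.natDegree_mul_C_le _ _).trans hf)
  obtain ⟨F, hF, hc⟩ := claimB k (d+1)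
  have hmem : aeval (U19 k) F ∈ (Algebra.adjoin k (s : Set (MvPolynomial (Fin 19) k)) :
          Set (MvPolynomial (Fin 19) k)) := by
    rw [hs]
    exact fun μ => U19_inv k F hF μ
  have h := (key _ hmem).2
  rw [phi_U] at h
  exact hc (Polynomial.coeff_eq_zero_of_natDegree_lt (by omega))
end nineteen

/-- The invariant algebra k[V]^{H₀} is not finitely generated:
there is no finite set of polynomials generating, as a k-algebra, the set of
polynomials f with h·f = f for all h ∈ H₀, where (h·f)(v) = f(h⁻¹·v). -/
theorem statement0 (k : Type*) [Field k] [IsAlgClosed k] [CharZero k] :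
    ¬ ∃ s : Finset (MvPolynomial (Fin 19) k),
      (Algebra.adjoin k (s : Set (MvPolynomial (Fin 19) k)) :
          Set (MvPolynomial (Fin 19) k)) =
        {f : MvPolynomial (Fin 19) k | ∀ μ : Fin 12 → k,
          MvPolynomial.aeval
            (fun i : Fin 19 => ∑ j : Fin 19,
              MvPolynomial.C ((hmat k μ)⁻¹ i j) * MvPolynomial.X j) f = f} := by
  exact not_fg_aux k
end
end

section
/- The subgroup H is epimorphic in G = SL_19(k): every regular function on SL_19(k) that is invariant under right translations by H is constant. Concretely, if f is a polynomial function on the space of 19×19 matrices over k (a multivariate polynomial in the 361 matrix entries) such that f(g·h) = f(g) for all g ∈ SL_19(k) and all h ∈ H, then f(g) = f(E_19) for all g ∈ SL_19(k), where E_19 is the identity matrix. -/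
open Matrix

noncomputable section

/-- The diagonal matrix d(s) = diag(s^15, s^15, s^15, s^15, s^{-4}, ..., s^{-4}). -/
def dmat (k : Type*) [Field k] (s : k) : Matrix (Fin 19) (Fin 19) k :=
  Matrix.diagonal fun i : Fin 19 => if (i : ℕ) < 4 then s ^ (15 : ℤ) else s ^ (-4 : ℤ)


section general
set_option linter.unusedSectionVars false
set_option linter.unusedSimpArgs false
open MvPolynomial

variable {n : Type*} [Fintype n] [DecidableEq n] {k : Type*} [Field k]

/-- The derivation given by the infinitesimal right translation by `A`. -/
noncomputable def DD (A : Matrix n n k) :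
    Derivation k (MvPolynomial (n × n) k) (MvPolynomial (n × n) k) :=
  mkDerivation k (fun q => ∑ r, C (A r q.2) * X (q.1, r))

lemma DD_X (A : Matrix n n k) (q : n × n) :
    DD A (X q) = ∑ r, C (A r q.2) * X (q.1, r) := by
  simp [DD]

lemma DD_add (A B : Matrix n n k) : DD (A + B) = DD A + DD B := by
  apply derivation_ext
  intro q
  simp [DD_X, add_mul, Finset.sum_add_distrib]

lemma DD_smul (c : k) (A : Matrix n n k) : DD (c • A) = c • DD A := by
  apply derivation_ext
  intro q
  simp [DD_X, Finset.smul_sum, smul_eq_C_mul, mul_assoc]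

lemma DD_lie (A B : Matrix n n k) (F : MvPolynomial (n × n) k) :
    DD (A * B - B * A) F = DD A (DD B F) - DD B (DD A F) := by
  have : DD (A * B - B * A) = ⁅DD A, DD B⁆ := by
    apply derivation_ext
    intro q
    have hC : ∀ (D : Derivation k (MvPolynomial (n × n) k) (MvPolynomial (n × n) k)) (a : k)
        (G : MvPolynomial (n × n) k), D (C a * G) = C a * D G := by
      intro D a G
      simp [Derivation.leibniz]
    simp only [Derivation.commutator_apply, DD_X, map_sum, hC,
      Matrix.sub_apply, Matrix.mul_apply, map_sub, sub_mul, Finset.sum_sub_distrib,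
      Finset.sum_mul, Finset.mul_sum, map_mul]
    congr 1
    · rw [Finset.sum_comm]
      refine Finset.sum_congr rfl fun i _ => Finset.sum_congr rfl fun j _ => by ring
    · rw [Finset.sum_comm]
      refine Finset.sum_congr rfl fun i _ => Finset.sum_congr rfl fun j _ => by ring
  rw [this, Derivation.commutator_apply]

/-- matrices annihilating `F`. -/
noncomputable def annF (F : MvPolynomial (n × n) k) : Submodule k (Matrix n n k) where
  carrier := {A | DD A F = 0}
  add_mem' := by
    intro a b ha hb
    simp only [Set.mem_ofPred_eq] at *
    rw [DD_add, Derivation.add_apply, ha, hb, add_zero]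
  zero_mem' := by
    have := DD_smul (0 : k) (0 : Matrix n n k)
    simp only [zero_smul] at this
    simp [this]
  smul_mem' := by
    intro c a ha
    simp only [Set.mem_ofPred_eq] at *
    rw [DD_smul, Derivation.smul_apply, ha, smul_zero]

lemma mem_annF {F : MvPolynomial (n × n) k} {A : Matrix n n k} :
    A ∈ annF F ↔ DD A F = 0 := Iff.rfl

lemma annF_lie {F : MvPolynomial (n × n) k} {A B : Matrix n n k}
    (hA : A ∈ annF F) (hB : B ∈ annF F) : A * B - B * A ∈ annF F := by
  rw [mem_annF] at *
  rw [DD_lie, hA, hB, map_zero, map_zero, sub_zero]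

/-- Chain rule. -/
lemma chain_rule (A : Matrix n n k) (γ : n × n → Polynomial k) (t : k)
    (h : ∀ q : n × n, (Polynomial.derivative (γ q)).eval t =
      ∑ r, (γ (q.1, r)).eval t * A r q.2) (F : MvPolynomial (n × n) k) :
    (Polynomial.derivative (aeval γ F)).eval t = eval (fun q => (γ q).eval t) (DD A F) := by
  have key : ∀ F : MvPolynomial (n × n) k,
      (aeval γ F).eval t = eval (fun q => (γ q).eval t) F := by
    intro F
    induction F using MvPolynomial.induction_on with
    | C a => simp
    | add p q hp hq => simp [hp, hq]
    | mul_X p q hp => simp [hp]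
  induction F using MvPolynomial.induction_on with
  | C a => simp
  | add p q hp hq => simp [hp, hq]
  | mul_X p q hp =>
    simp only [map_mul, aeval_X, Polynomial.derivative_mul, Polynomial.eval_add,
      Polynomial.eval_mul, hp, key, h, Derivation.leibniz, smul_eq_mul, map_add, DD_X, map_sum,
      eval_X, eval_C]
    have : ∑ r, (γ (q.1, r)).eval t * A r q.2 = ∑ r, A r q.2 * (γ (q.1, r)).eval t :=
      Finset.sum_congr rfl fun i _ => mul_comm _ _
    rw [this]
    ring

lemma aeval_eval (γ : n × n → Polynomial k) (t : k) (F : MvPolynomial (n × n) k) :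
      (aeval γ F).eval t = eval (fun q => (γ q).eval t) F := by
    induction F using MvPolynomial.induction_on with
    | C a => simp
    | add p q hp hq => simp [hp, hq]
    | mul_X p q hp => simp [hp]

/-- Evaluate a polynomial at a matrix. -/
noncomputable def ev (F : MvPolynomial (n × n) k) (g : Matrix n n k) : k :=
  eval (fun q => g q.1 q.2) F

lemma eq_zero_of_ev [CharZero k] (F : MvPolynomial (n × n) k)
    (h : ∀ g : Matrix n n k, g.det ≠ 0 → ev F g = 0) : F = 0 := by
  have hdet := det_mvPolynomialX_ne_zero n k
  have : (mvPolynomialX n n k).det * F = 0 := by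
    apply MvPolynomial.funext
    intro x
    have hx : eval x (mvPolynomialX n n k).det = (Matrix.of fun i j => x (i, j)).det := by
      rw [RingHom.map_det]
      congr 1
      ext i j
      simp
    rw [map_mul, map_zero, hx]
    by_cases h0 : (Matrix.of fun i j => x (i, j)).det = 0
    · rw [h0, zero_mul]
    · have := h _ h0
      simp only [ev, Matrix.of_apply] at this
      rw [this, mul_zero]
  exact (mul_eq_zero.mp this).resolve_left hdet

/-- Invariance under a one-parameter unipotent group gives infinitesimal invariance. -/
lemma annF_of_inv [CharZero k] (F : MvPolynomial (n × n) k) (A : Matrix n n k)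
    (h : ∀ g : Matrix n n k, g.det ≠ 0 → ∀ t : k, ev F (g * (1 + t • A)) = ev F g) :
    A ∈ annF F := by
  rw [mem_annF]
  apply eq_zero_of_ev
  intro g hg
  have h1 := chain_rule A (fun q => Polynomial.C (g q.1 q.2) +
    Polynomial.C ((g * A) q.1 q.2) * Polynomial.X) 0 (by
      intro q
      rw [Matrix.mul_apply]
      simp [Polynomial.eval_finsetSum]) F
  have h2 : aeval (fun q : n × n => Polynomial.C (g q.1 q.2) +
    Polynomial.C ((g * A) q.1 q.2) * Polynomial.X) F = Polynomial.C (ev F g) := by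
    apply Polynomial.funext
    intro t
    rw [aeval_eval, Polynomial.eval_C, ← h g hg t]
    exact congrArg (fun z => eval z F) (by funext q; simp [mul_add]; try ring)
  rw [h2] at h1
  simpa [ev] using h1.symm

lemma inv_of_annF [CharZero k] (F : MvPolynomial (n × n) k) (A : Matrix n n k) (hA2 : A * A = 0)
    (hA : A ∈ annF F) (g : Matrix n n k) (t : k) : ev F (g * (1 + t • A)) = ev F g := by
  rw [mem_annF] at hA
  set P := aeval (fun q : n × n => Polynomial.C (g q.1 q.2) +
    Polynomial.C ((g * A) q.1 q.2) * Polynomial.X) F with hP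
  have h1 : Polynomial.derivative P = 0 := by
    apply Polynomial.funext
    intro t
    rw [hP, chain_rule A _ t _ F, hA]
    · simp
    · intro q
      have e : g * A = (g + t • (g * A)) * A := by
        rw [add_mul, smul_mul_assoc, mul_assoc, hA2]; simp
      have := congrFun (congrFun e q.1) q.2
      rw [Matrix.mul_apply (M := g + _)] at this
      simp only [Matrix.add_apply, Matrix.smul_apply, smul_eq_mul] at this
      simp only [Polynomial.derivative_add, Polynomial.derivative_C, Polynomial.derivative_C_mul,
        Polynomial.derivative_X, mul_one, zero_add, Polynomial.eval_C, Polynomial.eval_add,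
        Polynomial.eval_mul, Polynomial.eval_X]
      exact this.trans (Finset.sum_congr rfl fun _ _ => by ring)
  have h2 := Polynomial.derivative_eq_zero.mp h1
  obtain ⟨c, hc⟩ := Polynomial.natDegree_eq_zero.mp h2
  have h3 : ∀ t : k, ev F (g * (1 + t • A)) = c := by
    intro t
    have : P.eval t = c := by rw [← hc]; simp
    rw [← this, hP, aeval_eval]
    exact congrArg (fun z => eval z F) (by funext q; simp [mul_add]; try ring)
  have h4 := h3 0
  rw [h3 t, ← h4]
  simp

lemma DD_single (r j : n) (c : k) (F : MvPolynomial (n × n) k) :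
    DD (Matrix.single r j c) F = ∑ p, C c * (X (p, r) * pderiv (p, j) F) := by
  have h0 : ∀ q : n × n, DD (Matrix.single r j c) (X q) =
      ∑ p, C c * (X (p, r) * pderiv (p, j) (X q : MvPolynomial (n × n) k)) := by
    rintro ⟨p, q⟩
    rw [DD_X, Finset.sum_eq_single r, Finset.sum_eq_single p]
    · by_cases h : j = q
      · subst h; simp
      · rw [pderiv_X_of_ne (by simpa using fun h' => h h'.symm)]; simp [Matrix.single_apply, h]
    · intro b _ hb
      rw [pderiv_X_of_ne (by simpa using fun h' => absurd h'.symm hb), mul_zero, mul_zero]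
    · simp
    · intro b _ hb
      simp [Matrix.single_apply, hb.symm]
    · simp
  induction F using MvPolynomial.induction_on with
  | C a => simp
  | add p q hp hq => simp [hp, hq, mul_add, Finset.sum_add_distrib]
  | mul_X p q hp =>
    rw [Derivation.leibniz, h0, hp, smul_eq_mul, smul_eq_mul, Finset.mul_sum, Finset.mul_sum,
      ← Finset.sum_add_distrib]
    refine Finset.sum_congr rfl fun i _ => ?_
    rw [Derivation.leibniz, smul_eq_mul, smul_eq_mul]
    ring

lemma coeff_X_mul_pderiv {σ : Type*} [DecidableEq σ] (i : σ) (F : MvPolynomial σ k) (m : σ →₀ ℕ) :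
    coeff m (X i * pderiv i F) = m i * coeff m F := by
  induction F using MvPolynomial.induction_on' with
  | monomial u a =>
    rw [X_mul_pderiv_monomial, coeff_smul, nsmul_eq_mul, coeff_monomial]
    by_cases h : u = m
    · subst h; simp
    · simp [h]
  | add p q hp hq => simp [mul_add, hp, hq]

end general


section form
set_option linter.unusedSectionVars false
set_option linter.unusedSimpArgs false
open MvPolynomial
variable {σ : Type*} [Fintype σ] [DecidableEq σ] {k : Type*} [Field k] [CharZero k]

/-- weight of a monomial -/
def cw (w : σ → ℚ) (m : σ →₀ ℕ) : ℚ := ∏ i, ((m i).factorial : ℚ) * w i ^ m i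

lemma cw_pos (w : σ → ℚ) (hw : ∀ i, 0 < w i) (m : σ →₀ ℕ) : 0 < cw w m :=
  Finset.prod_pos fun i _ => mul_pos (by exact_mod_cast Nat.factorial_pos _) (pow_pos (hw i) _)

lemma cw_add_single (w : σ → ℚ) (m : σ →₀ ℕ) (a : σ) :
    cw w (m + Finsupp.single a 1) = cw w m * ((m a + 1) * w a) := by
  unfold cw
  rw [← Finset.mul_prod_erase _ _ (Finset.mem_univ a),
    ← Finset.mul_prod_erase (a := a) Finset.univ (fun i => ((m i).factorial : ℚ) * w i ^ m i)
      (Finset.mem_univ a)]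
  have : ∏ x ∈ Finset.univ.erase a, (((m + Finsupp.single a 1 : σ →₀ ℕ) x).factorial : ℚ) *
      w x ^ (m + Finsupp.single a 1 : σ →₀ ℕ) x = ∏ x ∈ Finset.univ.erase a,
        ((m x).factorial : ℚ) * w x ^ m x := by
    refine Finset.prod_congr rfl fun x hx => ?_
    have hx' : a ≠ x := (Finset.ne_of_mem_erase hx).symm
    simp [Finsupp.single_apply, hx']
  rw [this]
  simp [Nat.factorial_succ, pow_succ]
  ring

/-- the weighted Fischer form, read through a `ℚ`-linear functional -/
noncomputable def BF (w : σ → ℚ) (φ : k →ₗ[ℚ] ℚ) (F G : MvPolynomial σ k) : ℚ :=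
  ∑ m ∈ F.support, cw w m * φ (coeff m F) * φ (coeff m G)

variable (w : σ → ℚ) (φ : k →ₗ[ℚ] ℚ)

lemma BF_eq (F G : MvPolynomial σ k) (S : Finset (σ →₀ ℕ)) (h : F.support ⊆ S) :
    BF w φ F G = ∑ m ∈ S, cw w m * φ (coeff m F) * φ (coeff m G) := by
  unfold BF
  refine Finset.sum_subset h fun m _ hm => ?_
  rw [notMem_support_iff.mp hm]; simp

lemma BF_symm (F G : MvPolynomial σ k) : BF w φ F G = BF w φ G F := by
  rw [BF_eq w φ F G (F.support ∪ G.support) Finset.subset_union_left,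
    BF_eq w φ G F (F.support ∪ G.support) Finset.subset_union_right]
  exact Finset.sum_congr rfl fun _ _ => by ring

lemma BF_add_right (F G H : MvPolynomial σ k) : BF w φ F (G + H) = BF w φ F G + BF w φ F H := by
  unfold BF
  rw [← Finset.sum_add_distrib]
  exact Finset.sum_congr rfl fun _ _ => by rw [coeff_add, map_add]; ring

lemma BF_add_left (F G H : MvPolynomial σ k) : BF w φ (F + G) H = BF w φ F H + BF w φ G H := by
  rw [BF_symm, BF_add_right, BF_symm w φ H F, BF_symm w φ H G]

lemma BF_smul_right (c : ℚ) (F G : MvPolynomial σ k) :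
    BF w φ F (C (c : k) * G) = c * BF w φ F G := by
  unfold BF
  rw [Finset.mul_sum]
  refine Finset.sum_congr rfl fun m _ => ?_
  rw [coeff_C_mul, ← Rat.smul_def, map_smul, smul_eq_mul]; ring

lemma BF_zero_right (F : MvPolynomial σ k) : BF w φ F 0 = 0 := by simp [BF]

lemma BF_sum_right {ι : Type*} (s : Finset ι) (F : MvPolynomial σ k) (G : ι → MvPolynomial σ k) :
    BF w φ F (∑ i ∈ s, G i) = ∑ i ∈ s, BF w φ F (G i) := by
  classical
  induction s using Finset.induction_on with
  | empty => simp [BF_zero_right]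
  | insert a s ha ih => rw [Finset.sum_insert ha, Finset.sum_insert ha, BF_add_right, ih]

lemma BF_sum_left {ι : Type*} (s : Finset ι) (F : MvPolynomial σ k) (G : ι → MvPolynomial σ k) :
    BF w φ (∑ i ∈ s, G i) F = ∑ i ∈ s, BF w φ (G i) F := by
  rw [BF_symm, BF_sum_right]
  exact Finset.sum_congr rfl fun i _ => BF_symm _ _ _ _

lemma BF_nonneg (hw : ∀ i, 0 < w i) (F : MvPolynomial σ k) : 0 ≤ BF w φ F F := by
  refine Finset.sum_nonneg fun m _ => ?_
  rw [mul_assoc]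
  exact mul_nonneg (cw_pos w hw m).le (mul_self_nonneg _)

lemma BF_eq_zero (hw : ∀ i, 0 < w i) (F : MvPolynomial σ k) (h : BF w φ F F = 0) (m : σ →₀ ℕ) :
    φ (coeff m F) = 0 := by
  by_cases hm : m ∈ F.support
  · have := (Finset.sum_eq_zero_iff_of_nonneg (fun m _ => by
      rw [mul_assoc]
      exact mul_nonneg (cw_pos w hw m).le (mul_self_nonneg _))).mp h m hm
    rw [mul_assoc] at this
    have := (mul_eq_zero.mp this).resolve_left (cw_pos w hw m).ne'
    exact mul_self_eq_zero.mp this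
  · rw [notMem_support_iff.mp hm, map_zero]

lemma BF_monomial (m : σ →₀ ℕ) (a : k) (G : MvPolynomial σ k) :
    BF w φ (monomial m a) G = cw w m * φ a * φ (coeff m G) := by
  rw [BF_eq w φ _ _ {m} support_monomial_subset]
  simp

lemma phi_nat (c : ℕ) (a : k) : φ (a * c) = φ a * c := by
  rw [mul_comm, ← nsmul_eq_mul, map_nsmul, nsmul_eq_mul, mul_comm]

lemma BF_adjoint (a b : σ) (F G : MvPolynomial σ k) :
    w b * BF w φ (X a * pderiv b F) G = w a * BF w φ F (X b * pderiv a G) := by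
  induction F using MvPolynomial.induction_on' with
  | monomial m α =>
    by_cases hb : m b = 0
    · have h2 : coeff m (X b * pderiv a G) = 0 := by
        rw [mul_comm, coeff_mul_X', if_neg (by simpa using hb)]
      rw [pderiv_monomial, hb, BF_monomial, h2]
      simp [BF]
    · obtain ⟨l, rfl⟩ : ∃ l, m = l + Finsupp.single b 1 := by
        refine ⟨m - Finsupp.single b 1, (tsub_add_cancel_of_le ?_).symm⟩
        rw [Finsupp.single_le_iff]; omega
      rw [pderiv_monomial, BF_monomial, mul_comm (X b), coeff_mul_X, coeff_pderiv,
        X, monomial_mul, BF_monomial, add_tsub_cancel_right, one_mul, add_comm (Finsupp.single a 1),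
        cw_add_single, cw_add_single, phi_nat]
      have := phi_nat φ (l a + 1) (coeff (l + Finsupp.single a 1) G)
      push_cast at this
      rw [this]
      simp
      ring
  | add p q hp hq =>
    rw [map_add, mul_add, BF_add_left, BF_add_left, mul_add, mul_add, hp, hq]

end form

section form2
open MvPolynomial
variable {n : Type*} [Fintype n] [DecidableEq n] {k : Type*} [Field k] [CharZero k]

lemma BF_DD (w : n → ℚ) (hw : ∀ i, 0 < w i) (φ : k →ₗ[ℚ] ℚ) (r j : n) (F G : MvPolynomial (n × n) k) :
    BF (fun q : n × n => w q.2) φ (DD (Matrix.single r j 1) F) G =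
      BF (fun q : n × n => w q.2) φ F (DD (Matrix.single j r ((w r / w j : ℚ) : k)) G) := by
  rw [DD_single, DD_single, BF_sum_left, BF_sum_right]
  refine Finset.sum_congr rfl fun p _ => ?_
  rw [map_one, one_mul, BF_smul_right]
  have := BF_adjoint (fun q : n × n => w q.2) φ (p, r) (p, j) F G
  simp only at this
  have h0 := (hw j).ne'
  field_simp
  rw [mul_comm, this]

lemma eq_zero_of_BF (w : n → ℚ) (hw : ∀ i, 0 < w i) (F : MvPolynomial (n × n) k)
    (h : ∀ φ : k →ₗ[ℚ] ℚ, BF (fun q : n × n => w q.2) φ F F = 0) : F = 0 := by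
  ext m
  rw [coeff_zero]
  refine (Module.forall_dual_apply_eq_zero_iff ℚ (coeff m F)).mp fun φ => ?_
  exact BF_eq_zero (fun q : n × n => w q.2) φ (fun q => hw q.2) F (h φ) m

/-- The positivity argument. -/
lemma positivity_arg {ι : Type*} [Fintype ι] (w : n → ℚ) (hw : ∀ i, 0 < w i) (p : ι → ℚ)
    (hp : ∀ i, 0 < p i) (x y : ι → Matrix n n k) (F : MvPolynomial (n × n) k)
    (hxy : ∀ (φ : k →ₗ[ℚ] ℚ) (i : ι) (G H : MvPolynomial (n × n) k),
      BF (fun q : n × n => w q.2) φ (DD (x i) G) H = BF (fun q : n × n => w q.2) φ G (DD (y i) H))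
    (hx : ∀ i, x i ∈ annF F)
    (hh : ∑ i, (p i : k) • (x i * y i - y i * x i) ∈ annF F) (i : ι) : y i ∈ annF F := by
  rw [mem_annF]
  apply eq_zero_of_BF w hw
  intro φ
  have hlin : ∀ s : Finset ι, DD (∑ i ∈ s, (p i : k) • (x i * y i - y i * x i)) F =
      ∑ i ∈ s, C (p i : k) * DD (x i) (DD (y i) F) := by
    classical
    intro s
    induction s using Finset.induction_on with
    | empty => simpa using (mem_annF.mp (annF F).zero_mem)
    | insert a s ha ih =>
      rw [Finset.sum_insert ha, Finset.sum_insert ha, DD_add, Derivation.add_apply, ih, DD_smul,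
        Derivation.smul_apply, DD_lie, mem_annF.mp (hx a), map_zero, sub_zero, smul_eq_C_mul]
  have h0 : ∑ i, p i * BF (fun q : n × n => w q.2) φ (DD (y i) F) (DD (y i) F) = 0 := by
    have : BF (fun q : n × n => w q.2) φ F (DD (∑ i, (p i : k) • (x i * y i - y i * x i)) F) = 0 := by
      rw [mem_annF.mp hh, BF_zero_right]
    rw [hlin, BF_sum_right] at this
    rw [← this]
    refine Finset.sum_congr rfl fun i _ => ?_
    rw [BF_smul_right, BF_symm _ _ F, hxy]
  have := (Finset.sum_eq_zero_iff_of_nonneg (fun i _ =>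
    mul_nonneg (hp i).le (BF_nonneg (fun q : n × n => w q.2) φ (fun q => hw q.2) _))).mp h0 i (Finset.mem_univ i)
  exact (mul_eq_zero.mp this).resolve_left (hp i).ne'

/-- If all off-diagonal infinitesimal translations annihilate `F`, then `F` is constant on `SL`. -/
lemma const_of_annF (F : MvPolynomial (n × n) k)
    (h : ∀ a b : n, a ≠ b → Matrix.single a b (1 : k) ∈ annF F) (g : Matrix n n k)
    (hg : g.det = 1) : ev F g = ev F 1 := by
  have htr : ∀ (t : TransvectionStruct n k) (g : Matrix n n k), ev F (g * t.toMatrix) = ev F g := by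
    rintro ⟨i, j, hij, c⟩ g
    have := inv_of_annF F (Matrix.single i j 1) (by simp [hij.symm]) (h i j hij) g c
    simpa [TransvectionStruct.toMatrix, transvection, Matrix.smul_single] using this
  have hL : ∀ (L : List (TransvectionStruct n k)) (g : Matrix n n k),
      ev F (g * (L.map TransvectionStruct.toMatrix).prod) = ev F g := by
    intro L
    induction L with
    | nil => simp
    | cons t L ih =>
      intro g
      rw [List.map_cons, List.prod_cons, ← mul_assoc, ih, htr]
  have hdeg : ∀ m ∈ F.support, ∀ a b : n, ∑ p, m (p, a) = ∑ p, m (p, b) := by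
    intro m hm a b
    by_cases hab : a = b
    · rw [hab]
    have h1 := annF_lie (h a b hab) (h b a (Ne.symm hab))
    simp only [Matrix.single_mul_single_same, mul_one] at h1
    have h2 : DD (Matrix.single a a (1 : k)) F = DD (Matrix.single b b (1 : k)) F := by
      have : Matrix.single a a (1 : k) = (Matrix.single a a (1 : k) - Matrix.single b b (1 : k)) +
        Matrix.single b b (1 : k) := by abel
      rw [this, DD_add, Derivation.add_apply, mem_annF.mp h1, zero_add]
    have h3 : ∀ a, coeff m (DD (Matrix.single a a (1 : k)) F) = (∑ p, m (p, a) : ℕ) * coeff m F := by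
      intro a
      rw [DD_single, coeff_sum]
      simp only [map_one, one_mul, coeff_X_mul_pderiv]
      rw [← Finset.sum_mul]
      push_cast
      rfl
    have h4 := congrArg (coeff m) h2
    rw [h3, h3] at h4
    exact_mod_cast mul_right_cancel₀ (mem_support_iff.mp hm) h4
  have hD : ∀ (d : n → k), ∏ i, d i = 1 → ∀ g : Matrix n n k, ev F (g * Matrix.diagonal d) = ev F g := by
    intro d hd g
    unfold ev
    rw [eval_eq', eval_eq']
    refine Finset.sum_congr rfl fun m hm => ?_
    congr 1
    simp only [Matrix.mul_diagonal, mul_pow, Finset.prod_mul_distrib]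
    have : ∏ q : n × n, d q.2 ^ m q = 1 := by
      rw [Fintype.prod_prod_type_right]
      simp only [Finset.prod_pow_eq_pow_sum]
      rcases isEmpty_or_nonempty n with he | ⟨⟨a⟩⟩
      · simp
      · rw [Finset.prod_congr rfl fun b _ => by rw [hdeg m hm b a], Finset.prod_pow, hd, one_pow]
    rw [this, mul_one]
  obtain ⟨L, L', D, hLD⟩ := Matrix.Pivot.exists_list_transvec_mul_diagonal_mul_list_transvec g
  have hdet : ∏ i, D i = 1 := by
    have := congrArg Matrix.det hLD
    simpa [hg, TransvectionStruct.det_toMatrix_prod] using this.symm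
  rw [hLD, hL, hD D hdet, ← one_mul (List.prod _), hL]

end form2


section generic
set_option linter.unusedSectionVars false
set_option linter.unusedSimpArgs false
open MvPolynomial
variable {n : Type*} [Fintype n] [DecidableEq n] {k : Type*} [Field k] [CharZero k]

/-- Spread a polynomial function on `SL` to one on `GL`, right translated by `c`. -/
lemma exists_extension (i0 : n) (c : Matrix n n k) (f : MvPolynomial (n × n) k) :
    ∃ (N : ℕ) (F : MvPolynomial (n × n) k), ∀ g : Matrix n n k, g.det ≠ 0 →
      ev F g = g.det ^ N * ev f (Matrix.diagonal (Function.update 1 i0 (g.det)⁻¹) * (g * c)) := by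
  induction f using MvPolynomial.induction_on with
  | C a => exact ⟨0, C a, fun g _ => by simp [ev]⟩
  | add p q hp hq =>
    obtain ⟨N, F, hF⟩ := hp
    obtain ⟨N', F', hF'⟩ := hq
    refine ⟨N + N', (mvPolynomialX n n k).det ^ N' * F + (mvPolynomialX n n k).det ^ N * F',
      fun g hg => ?_⟩
    have hx : eval (fun q : n × n => g q.1 q.2) (mvPolynomialX n n k).det = g.det := by
      rw [RingHom.map_det]
      congr 1
      ext i j
      simp
    have h1 := hF g hg
    have h2 := hF' g hg
    simp only [ev, map_add, map_mul, map_pow, hx] at *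
    rw [h1, h2]
    ring
  | mul_X p q hp =>
    obtain ⟨N, F, hF⟩ := hp
    refine ⟨N + 1, F * ((∑ r, C (c r q.2) * X (q.1, r)) *
      (if q.1 = i0 then 1 else (mvPolynomialX n n k).det)), fun g hg => ?_⟩
    have hx : eval (fun q : n × n => g q.1 q.2) (mvPolynomialX n n k).det = g.det := by
      rw [RingHom.map_det]
      congr 1
      ext i j
      simp
    have h1 := hF g hg
    have h3 : ∑ r, c r q.2 * g q.1 r = (g * c) q.1 q.2 := by
      rw [Matrix.mul_apply]
      exact Finset.sum_congr rfl fun _ _ => mul_comm _ _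
    simp only [ev, map_mul, map_sum, eval_C, eval_X] at *
    rw [h1, h3, Matrix.diagonal_mul]
    by_cases hq : q.1 = i0
    · rw [if_pos hq, hq]
      simp
      field_simp
      ring
    · rw [if_neg hq, hx]
      simp [hq]
      ring

lemma split_lemma {ι : Type*} [DecidableEq ι] (S : Finset ι) (r j : ι → n) (w : ι → k)
    (hr : ∀ e ∈ S, ∀ e' ∈ S, r e = r e' → e = e')
    (hj : ∀ e ∈ S, ∀ e' ∈ S, j e = j e' → e = e')
    (hrj : ∀ e e', r e ≠ j e') :
    (∑ e ∈ S, Matrix.single (r e) (j e) (1 : k)) * (∑ e ∈ S, Matrix.single (j e) (r e) (w e)) -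
    (∑ e ∈ S, Matrix.single (j e) (r e) (w e)) * (∑ e ∈ S, Matrix.single (r e) (j e) (1 : k)) =
    ∑ e ∈ S, (Matrix.single (r e) (r e) (w e) - Matrix.single (j e) (j e) (w e)) := by
  rw [Finset.sum_sub_distrib, Finset.sum_mul, Finset.sum_mul]
  congr 1
  · refine Finset.sum_congr rfl fun e he => ?_
    rw [Finset.mul_sum, Finset.sum_eq_single e]
    · simp
    · intro b hb hbe
      exact Matrix.single_mul_single_of_ne _ _ _ _ (fun h => hbe (hj b hb e he h.symm)) _
    · exact fun h => absurd he h
  · refine Finset.sum_congr rfl fun e he => ?_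
    rw [Finset.mul_sum, Finset.sum_eq_single e]
    · simp
    · intro b hb hbe
      exact Matrix.single_mul_single_of_ne _ _ _ _ (fun h => hbe (hr b hb e he h.symm)) _
    · exact fun h => absurd he h

lemma bracket1 {ι : Type*} [DecidableEq ι] (S : Finset ι) (r j : ι → n) (w : ι → k)
    (hr : ∀ e ∈ S, ∀ e' ∈ S, r e = r e' → e = e')
    (hj : ∀ e ∈ S, ∀ e' ∈ S, j e = j e' → e = e')
    (hrj : ∀ e e', r e ≠ j e') (e : ι) (he : e ∈ S) (c : k) :
    (∑ e ∈ S, (Matrix.single (r e) (r e) (w e) - Matrix.single (j e) (j e) (w e))) *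
      Matrix.single (r e) (j e) c -
      Matrix.single (r e) (j e) c *
      (∑ e ∈ S, (Matrix.single (r e) (r e) (w e) - Matrix.single (j e) (j e) (w e))) =
      Matrix.single (r e) (j e) (2 * w e * c) := by
  rw [Finset.sum_mul, Finset.mul_sum, Finset.sum_eq_single e, Finset.sum_eq_single e]
  · rw [sub_mul, mul_sub, Matrix.single_mul_single_same, Matrix.single_mul_single_same,
      Matrix.single_mul_single_of_ne _ _ _ _ (hrj e e).symm,
      Matrix.single_mul_single_of_ne _ _ _ _ (hrj e e).symm, sub_zero, zero_sub, sub_neg_eq_add,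
      ← Matrix.single_add]
    congr 1; ring
  · intro b hb hbe
    rw [mul_sub, Matrix.single_mul_single_of_ne _ _ _ _ (hrj b e).symm,
      Matrix.single_mul_single_of_ne _ _ _ _ (fun h => hbe (hj b hb e he h.symm)), sub_zero]
  · exact fun h => absurd he h
  · intro b hb hbe
    rw [sub_mul, Matrix.single_mul_single_of_ne _ _ _ _ (hrj e b).symm,
      Matrix.single_mul_single_of_ne _ _ _ _ (fun h => hbe (hr b hb e he h)), sub_zero]
  · exact fun h => absurd he h

lemma vandermonde_mem {V ι : Type*} [AddCommGroup V] [Module k V] [DecidableEq ι] (L : Submodule k V)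
    (S : Finset ι) (w : ι → k) (v : ι → V) (hw : Set.InjOn w S)
    (h : ∀ m : ℕ, ∑ e ∈ S, w e ^ m • v e ∈ L) (e : ι) (he : e ∈ S) : v e ∈ L := by
  have hP : ∀ P : Polynomial k, ∑ e ∈ S, P.eval (w e) • v e ∈ L := by
    intro P
    induction P using Polynomial.induction_on' with
    | add p q hp hq =>
      simp only [Polynomial.eval_add, add_smul, Finset.sum_add_distrib]
      exact L.add_mem hp hq
    | monomial m a =>
      simp only [Polynomial.eval_monomial, mul_smul]
      rw [← Finset.smul_sum]
      exact L.smul_mem _ (h m)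
  have := hP (Lagrange.basis S w e)
  rw [Finset.sum_eq_single e] at this
  · rwa [Lagrange.eval_basis_self hw he, one_smul] at this
  · intro b hb hbe
    rw [Lagrange.eval_basis_of_ne hbe.symm hb, zero_smul]
  · exact fun h => absurd he h

lemma half_split {ι : Type*} [DecidableEq ι] (F : MvPolynomial (n × n) k) (H : Matrix n n k)
    (hH : H ∈ annF F) (S : Finset ι) (w : ι → k) (v : ι → Matrix n n k) (hw : Set.InjOn w S)
    (hb : ∀ e ∈ S, H * v e - v e * H = (2 * w e) • v e) (hv : ∑ e ∈ S, v e ∈ annF F)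
    (e : ι) (he : e ∈ S) : v e ∈ annF F := by
  refine vandermonde_mem (annF F) S w v hw (fun m => ?_) e he
  induction m with
  | zero => simpa using hv
  | succ m ih =>
    have h1 := (annF F).smul_mem (2⁻¹ : k) (annF_lie hH ih)
    convert h1 using 1
    rw [Finset.mul_sum, Finset.sum_mul, ← Finset.sum_sub_distrib, Finset.smul_sum]
    refine Finset.sum_congr rfl fun e he => ?_
    rw [mul_smul_comm, smul_mul_assoc, ← smul_sub, hb e he, smul_smul, smul_smul]
    congr 1
    field_simp
    ring

lemma all_edges {ι : Type*} [DecidableEq ι] (F : MvPolynomial (n × n) k)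
    (S : Finset ι) (r j : ι → n) (w : ι → k)
    (hr : ∀ e ∈ S, ∀ e' ∈ S, r e = r e' → e = e')
    (hj : ∀ e ∈ S, ∀ e' ∈ S, j e = j e' → e = e')
    (hrj : ∀ e e', r e ≠ j e') (hw : Set.InjOn w S) (hw0 : ∀ e, w e ≠ 0)
    (hx : ∑ e ∈ S, Matrix.single (r e) (j e) (1 : k) ∈ annF F)
    (hy : ∑ e ∈ S, Matrix.single (j e) (r e) (w e) ∈ annF F) (e : ι) (he : e ∈ S) :
    Matrix.single (r e) (j e) (1 : k) ∈ annF F ∧ Matrix.single (j e) (r e) (1 : k) ∈ annF F := by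
  have hH := annF_lie hx hy
  rw [split_lemma S r j w hr hj hrj] at hH
  constructor
  · refine half_split F _ hH S w (fun e => Matrix.single (r e) (j e) (1 : k)) hw ?_ hx e he
    intro e he
    rw [bracket1 S r j w hr hj hrj e he, Matrix.smul_single, smul_eq_mul]
  · have hH' := (annF F).neg_mem hH
    have h1 := half_split F _ hH' S w (fun e => Matrix.single (j e) (r e) (w e)) hw ?_ hy e he
    · have := (annF F).smul_mem (w e)⁻¹ h1
      simpa [Matrix.smul_single, hw0 e] using this
    · intro e he
      have := bracket1 S j r w hj hr (fun e e' => (hrj e' e).symm) e he (w e)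
      rw [← Finset.sum_neg_distrib]
      simp only [neg_sub]
      rw [this, Matrix.smul_single, smul_eq_mul]

lemma edge_trans (F : MvPolynomial (n × n) k) (a b c : n)
    (h1 : a = b ∨ Matrix.single a b (1 : k) ∈ annF F)
    (h2 : b = c ∨ Matrix.single b c (1 : k) ∈ annF F) :
    a = c ∨ Matrix.single a c (1 : k) ∈ annF F := by
  rcases h1 with rfl | h1
  · exact h2
  rcases h2 with rfl | h2
  · exact Or.inr h1
  by_cases hac : a = c
  · exact Or.inl hac
  · right
    have := annF_lie h1 h2
    rwa [Matrix.single_mul_single_same, Matrix.single_mul_single_of_ne _ _ _ _ (Ne.symm hac),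
      sub_zero, mul_one] at this

/-- Invariance under the one-parameter group `S`. -/
lemma annF_diag (F : MvPolynomial (n × n) k) (A : n → Prop) [DecidablePred A]
    (h : ∀ g : Matrix n n k, g.det ≠ 0 → ∀ s : k, s ≠ 0 →
      ev F (g * Matrix.diagonal (fun i => if A i then s ^ (15 : ℤ) else s ^ (-4 : ℤ))) = ev F g) :
    Matrix.diagonal (fun i => if A i then (15 : k) else -4) ∈ annF F := by
  rw [mem_annF]
  apply eq_zero_of_ev
  intro g hg
  have h1 := chain_rule (Matrix.diagonal (fun i => if A i then (19 : k) else 0))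
    (fun q => Polynomial.C (g q.1 q.2) * (if A q.2 then Polynomial.X ^ 19 else 1)) 1 (by
      intro q
      simp only [Matrix.diagonal_apply]
      simp
      split_ifs
      · simp
        ring_nf
        try simp
      · simp) F
  have h2 := chain_rule (Matrix.diagonal (fun i => (4 : k)))
    (fun q => Polynomial.C (g q.1 q.2) * Polynomial.X ^ 4) 1 (by
      intro q
      simp only [Matrix.diagonal_apply]
      simp
      left; norm_num) F
  have h3 : aeval (fun q : n × n => Polynomial.C (g q.1 q.2) *
      (if A q.2 then Polynomial.X ^ 19 else 1)) F =
      aeval (fun q : n × n => Polynomial.C (g q.1 q.2) * Polynomial.X ^ 4) F := by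
    apply mul_left_cancel₀ (Polynomial.X_ne_zero (R := k))
    apply Polynomial.funext
    intro t
    rw [Polynomial.eval_mul, Polynomial.eval_mul, Polynomial.eval_X, aeval_eval, aeval_eval]
    by_cases ht : t = 0
    · rw [ht, zero_mul, zero_mul]
    congr 1
    have := h (t ^ 4 • g) (by rw [Matrix.det_smul]; exact mul_ne_zero (pow_ne_zero _ (pow_ne_zero _ ht)) hg) t ht
    unfold ev at this
    convert this using 3
    · funext q
      rw [Matrix.mul_diagonal, Matrix.smul_apply, smul_eq_mul]
      split_ifs
      · simp
        ring
      · simp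
        field_simp
    · funext q
      simp
      ring
  rw [h3, h2] at h1
  have e1 : (fun q : n × n => (Polynomial.C (g q.1 q.2) *
      (if A q.2 then Polynomial.X ^ 19 else 1)).eval 1) = fun q => g q.1 q.2 := by
    funext q; split_ifs <;> simp
  have e2 : (fun q : n × n => (Polynomial.C (g q.1 q.2) * Polynomial.X ^ 4).eval 1)
      = fun q => g q.1 q.2 := by
    funext q; simp
  rw [e1, e2] at h1
  have e3 : (Matrix.diagonal (fun i => if A i then (19 : k) else 0)) =
      Matrix.diagonal (fun i => if A i then (15 : k) else -4) + Matrix.diagonal (fun i => (4 : k)) := by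
    rw [Matrix.diagonal_add]
    congr 1
    funext i
    split_ifs <;> norm_num
  rw [e3, DD_add, Derivation.add_apply, map_add] at h1
  unfold ev
  exact left_eq_add.mp (by rw [add_comm]; exact h1)

end generic


section concrete
set_option linter.unusedSectionVars false
set_option linter.unusedSimpArgs false
variable {k : Type*} [Field k]

/-- Edge label (which generator). -/
def ei : Fin 26 → Fin 12 :=
  ![0, 0, 0, 1, 1, 2, 2, 2, 3, 3, 4, 4, 5, 5, 6, 6, 7, 7, 8, 8, 9, 9, 10, 10, 11, 11]
/-- Edge source (column). -/
def ejj : Fin 26 → Fin 4 :=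
  ![1, 2, 3, 0, 1, 0, 1, 2, 0, 2, 0, 2, 0, 3, 0, 3, 0, 1, 0, 2, 0, 2, 0, 3, 0, 3]
/-- Edge target (row). -/
def err : Fin 26 → Fin 15 :=
  ![0, 3, 6, 0, 1, 1, 2, 11, 3, 4, 4, 5, 6, 7, 7, 8, 9, 10, 10, 11, 11, 12, 12, 13, 13, 14]
/-- Edge target in `Fin 19`. -/
def er (e : Fin 26) : Fin 19 := Fin.natAdd 4 (err e)
/-- Edge source in `Fin 19`. -/
def ej (e : Fin 26) : Fin 19 := Fin.castAdd 15 (ejj e)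

/-- Row operation on the last 15 coordinates. -/
noncomputable def cB (k : Type*) [Field k] : Matrix (Fin 15) (Fin 15) k :=
  transvection 9 0 (-1) * transvection 10 1 (-1)

/-- Change of basis. -/
noncomputable def cM (k : Type*) [Field k] : Matrix (Fin 19) (Fin 19) k :=
  Matrix.reindex finSumFinEquiv finSumFinEquiv (Matrix.fromBlocks 1 0 0 (cB k))

/-- Change of parameters. -/
def mus (ν : Fin 12 → k) : Fin 12 → k :=
  ![ν 0, ν 1, ν 2, ν 3, ν 4, ν 5, ν 6, ν 7 + ν 1, ν 8 + ν 2, ν 9, ν 10, ν 11]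

/-- Transformed matrix. -/
def Nmat (ν : Fin 12 → k) : Matrix (Fin 15) (Fin 4) k :=
  !![ν 1, ν 0, 0, 0;
     ν 2, ν 1, 0, 0;
     0, ν 2, 0, 0;
     ν 3, 0, ν 0, 0;
     ν 4, 0, ν 3, 0;
     0, 0, ν 4, 0;
     ν 5, 0, 0, ν 0;
     ν 6, 0, 0, ν 5;
     0, 0, 0, ν 6;
     ν 7, 0, 0, 0;
     ν 8, ν 7, 0, 0;
     ν 9, 0, ν 8 + ν 2, 0;
     ν 10, 0, ν 9, 0;
     ν 11, 0, 0, ν 10;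
     0, 0, 0, ν 11]

lemma cB_mul (ν : Fin 12 → k) : cB k * Mmat k (mus ν) = Nmat ν := by
  ext a b
  rw [cB, Matrix.mul_assoc]
  by_cases h9 : a = 9
  · subst h9
    rw [transvection_mul_apply_same, transvection_mul_apply_of_ne _ _ _ _ (by decide),
      transvection_mul_apply_of_ne _ _ _ _ (by decide)]
    fin_cases b <;> simp [Mmat, Nmat, mus]
  rw [transvection_mul_apply_of_ne _ _ _ _ h9]
  by_cases h10 : a = 10
  · subst h10
    rw [transvection_mul_apply_same]
    fin_cases b <;> simp [Mmat, Nmat, mus]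
  rw [transvection_mul_apply_of_ne _ _ _ _ h10]
  fin_cases a <;> first | exact absurd rfl h9 | exact absurd rfl h10 | (fin_cases b <;> simp [Mmat, Nmat, mus])

set_option maxHeartbeats 4000000 in
lemma Nmat_eq (ν : Fin 12 → k) :
    Nmat ν = ∑ e, ν (ei e) • Matrix.single (err e) (ejj e) (1 : k) := by
  ext a b
  rw [Matrix.sum_apply]
  simp only [Matrix.smul_apply, Matrix.single_apply, smul_eq_mul, mul_ite, mul_one, mul_zero]
  fin_cases a <;> fin_cases b <;>
    simp [Nmat, Fin.sum_univ_succ, ei, err, ejj] <;> exact add_comm _ _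

end concrete


section concrete2
set_option linter.unusedSectionVars false
set_option linter.deprecated false
set_option linter.unusedSimpArgs false
variable {k : Type*} [Field k]

/-- The edges with label `i`. -/
def eS (i : Fin 12) : Finset (Fin 26) := Finset.univ.filter fun e => ei e = i

/-- The generators. -/
noncomputable def xm (k : Type*) [Field k] (i : Fin 12) : Matrix (Fin 19) (Fin 19) k :=
  ∑ e ∈ eS i, Matrix.single (er e) (ej e) (1 : k)

lemma single_block (a : Fin 15) (b : Fin 4) :
    Matrix.single (Fin.natAdd 4 a) (Fin.castAdd 15 b) (1 : k) =
    Matrix.reindex finSumFinEquiv finSumFinEquiv (Matrix.fromBlocks (0 : Matrix (Fin 4) (Fin 4) k)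
      (0 : Matrix (Fin 4) (Fin 15) k) (Matrix.single a b 1) (0 : Matrix (Fin 15) (Fin 15) k)) := by
  have h : Matrix.fromBlocks (0 : Matrix (Fin 4) (Fin 4) k)
      (0 : Matrix (Fin 4) (Fin 15) k) (Matrix.single a b 1) (0 : Matrix (Fin 15) (Fin 15) k) =
      Matrix.single (Sum.inr a) (Sum.inl b) 1 := by
    ext (i | i) (j | j) <;> simp [Matrix.single_apply]
  rw [h]
  ext i j
  rw [Matrix.reindex_apply, Matrix.submatrix_apply, Matrix.single_apply, Matrix.single_apply]
  simp only [Equiv.eq_symm_apply, finSumFinEquiv_apply_left, finSumFinEquiv_apply_right]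

/-- The lower-left block embedding. -/
noncomputable def emb (k : Type*) [Field k] :
    Matrix (Fin 15) (Fin 4) k →ₗ[k] Matrix (Fin 19) (Fin 19) k where
  toFun N := Matrix.reindex finSumFinEquiv finSumFinEquiv
    (Matrix.fromBlocks (0 : Matrix (Fin 4) (Fin 4) k)
      (0 : Matrix (Fin 4) (Fin 15) k) N (0 : Matrix (Fin 15) (Fin 15) k))
  map_add' := by
    intro x y
    rw [← (Matrix.reindexLinearEquiv_apply k k), ← (Matrix.reindexLinearEquiv_apply k k),
      ← (Matrix.reindexLinearEquiv_apply k k), ← map_add, Matrix.fromBlocks_add]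
    simp
  map_smul' := by
    intro c x
    rw [← (Matrix.reindexLinearEquiv_apply k k), ← (Matrix.reindexLinearEquiv_apply k k),
      RingHom.id_apply, ← map_smul, Matrix.fromBlocks_smul]
    simp

lemma emb_single (e : Fin 26) : emb k (Matrix.single (err e) (ejj e) 1) =
    Matrix.single (er e) (ej e) 1 := (single_block _ _).symm

lemma emb_Nmat (t : k) (i : Fin 12) : emb k (Nmat (Pi.single i t)) = t • xm k i := by
  rw [Nmat_eq, map_sum, xm, Finset.smul_sum, eS, Finset.sum_filter]
  refine Finset.sum_congr rfl fun e _ => ?_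
  rw [map_smul, emb_single]
  by_cases h : ei e = i
  · rw [if_pos h, h, Pi.single_eq_same]
  · rw [if_neg h, Pi.single_eq_of_ne h, zero_smul]

lemma reindex_mul' (A B : Matrix (Fin 4 ⊕ Fin 15) (Fin 4 ⊕ Fin 15) k) :
    (Matrix.reindex finSumFinEquiv finSumFinEquiv A : Matrix (Fin 19) (Fin 19) k) *
    (Matrix.reindex finSumFinEquiv finSumFinEquiv B : Matrix (Fin 19) (Fin 19) k) =
    Matrix.reindex finSumFinEquiv finSumFinEquiv (A * B) := by
  simp only [Matrix.reindex_apply]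
  exact Matrix.submatrix_mul_equiv _ _ _ _ _

lemma one_add_emb (N : Matrix (Fin 15) (Fin 4) k) : (1 : Matrix (Fin 19) (Fin 19) k) + emb k N =
    (Matrix.reindex finSumFinEquiv finSumFinEquiv (Matrix.fromBlocks
      (1 : Matrix (Fin 4) (Fin 4) k) 0 N (1 : Matrix (Fin 15) (Fin 15) k)) :
      Matrix (Fin 19) (Fin 19) k) := by
  have : (1 : Matrix (Fin 19) (Fin 19) k) = Matrix.reindex finSumFinEquiv finSumFinEquiv
      (1 : Matrix (Fin 4 ⊕ Fin 15) (Fin 4 ⊕ Fin 15) k) := by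
    simp
  rw [this, ← Matrix.fromBlocks_one]
  simp only [emb, LinearMap.coe_mk, AddHom.coe_mk]
  rw [← (Matrix.reindexLinearEquiv_apply k k), ← (Matrix.reindexLinearEquiv_apply k k),
      ← (Matrix.reindexLinearEquiv_apply k k), ← map_add, Matrix.fromBlocks_add]
  simp

lemma det_one_add_emb (N : Matrix (Fin 15) (Fin 4) k) : (1 + emb k N).det = 1 := by
  rw [one_add_emb, Matrix.det_reindex_self, Matrix.det_fromBlocks_zero₁₂]
  simp

lemma det_hmat (μ : Fin 12 → k) : (hmat k μ).det = 1 := by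
  rw [hmat, Matrix.det_reindex_self, Matrix.det_fromBlocks_zero₁₂]
  simp

lemma det_cM : (cM k).det = 1 := by
  rw [cM, Matrix.det_reindex_self, Matrix.det_fromBlocks_zero₁₂, cB, Matrix.det_mul,
    det_transvection_of_ne _ _ (by decide), det_transvection_of_ne _ _ (by decide)]
  simp

lemma cM_hmat (t : k) (i : Fin 12) :
    cM k * hmat k (mus (Pi.single i t)) = (1 + t • xm k i) * cM k := by
  rw [← emb_Nmat, one_add_emb, cM, hmat, reindex_mul', reindex_mul', Matrix.fromBlocks_multiply,
    Matrix.fromBlocks_multiply, cB_mul]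
  simp

lemma hmat_zero : hmat k 0 = 1 := by
  have : Mmat k 0 = 0 := by
    ext a b
    fin_cases a <;> fin_cases b <;> rfl
  rw [hmat, this, Matrix.fromBlocks_one]
  simp

lemma dmat_one : dmat k 1 = 1 := by
  simp [dmat]

lemma det_dmat (s : k) (hs : s ≠ 0) : (dmat k s).det = 1 := by
  rw [dmat, Matrix.det_diagonal]
  simp [Fin.prod_univ_succ]
  field_simp

lemma cM_dmat (s : k) : cM k * dmat k s = dmat k s * cM k := by
  have : dmat k s = Matrix.reindex finSumFinEquiv finSumFinEquiv
      (Matrix.fromBlocks (s ^ (15 : ℤ) • (1 : Matrix (Fin 4) (Fin 4) k)) 0 0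
        (s ^ (-4 : ℤ) • (1 : Matrix (Fin 15) (Fin 15) k))) := by
    rw [dmat, Matrix.smul_one_eq_diagonal, Matrix.smul_one_eq_diagonal, Matrix.fromBlocks_diagonal,
      Matrix.reindex_apply, Matrix.submatrix_diagonal_equiv]
    congr 1
    funext i
    refine Fin.addCases (m := 4) (n := 15) (fun i => ?_) (fun i => ?_) i
    · rw [if_pos (by simp)]
      exact (congrArg (Sum.elim (fun _ : Fin 4 => s ^ (15 : ℤ)) (fun _ : Fin 15 => s ^ (-4 : ℤ)))
        (finSumFinEquiv_symm_apply_castAdd (n := 15) i)).symm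
    · rw [if_neg (by simp)]
      exact (congrArg (Sum.elim (fun _ : Fin 4 => s ^ (15 : ℤ)) (fun _ : Fin 15 => s ^ (-4 : ℤ)))
        (finSumFinEquiv_symm_apply_natAdd (m := 4) i)).symm
  rw [this, cM, reindex_mul', reindex_mul', Matrix.fromBlocks_multiply,
    Matrix.fromBlocks_multiply]
  simp

end concrete2

section concrete3
set_option linter.unusedSectionVars false
set_option linter.unusedSimpArgs false
variable {k : Type*} [Field k] [CharZero k]

/-- Weights of the Fischer form. -/
def wq : Fin 19 → ℚ :=
  ![1, 1, 1, 1, 11, 121, 1452, 8, 16, 48, 7, 49/5, 588/25, 132, 121, 484, 1089, 2541, 30492/5]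
/-- Coefficients. -/
def pq : Fin 12 → ℚ :=
  ![1, 1/11, 1/121, 1/2, 1/4, 5/7, 25/49, 1/11, 1/121, 1/121, 1/363, 5/2541]

lemma wq_pos : ∀ i, 0 < wq i := by decide +kernel
lemma pq_pos : ∀ i, 0 < pq i := by decide +kernel
lemma wq_ej : ∀ e, wq (ej e) = 1 := by decide +kernel
lemma er_inj : ∀ i, ∀ e ∈ eS i, ∀ e' ∈ eS i, er e = er e' → e = e' := by decide +kernel
lemma ej_inj : ∀ i, ∀ e ∈ eS i, ∀ e' ∈ eS i, ej e = ej e' → e = e' := by decide +kernel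
lemma er_ne_ej : ∀ e e', er e ≠ ej e' := by decide +kernel
lemma wq_inj : ∀ i, ∀ e ∈ eS i, ∀ e' ∈ eS i, wq (er e) = wq (er e') → e = e' := by decide +kernel
lemma wq_sum : ∀ a : Fin 19, (∑ e, if er e = a then pq (ei e) * wq (er e) else 0) -
    (∑ e, if ej e = a then pq (ei e) * wq (er e) else 0) = -3 * (if (a : ℕ) < 4 then 15 else -4) := by
  decide +kernel

/-- The adjoint generators. -/
noncomputable def ym (k : Type*) [Field k] (i : Fin 12) : Matrix (Fin 19) (Fin 19) k :=
  ∑ e ∈ eS i, Matrix.single (ej e) (er e) ((wq (er e) : ℚ) : k)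

lemma DD_sum {n : Type*} [Fintype n] [DecidableEq n] {ι : Type*} (S : Finset ι)
    (A : ι → Matrix n n k) (F : MvPolynomial (n × n) k) :
    DD (∑ e ∈ S, A e) F = ∑ e ∈ S, DD (A e) F := by
  classical
  induction S using Finset.induction_on with
  | empty => simpa using (mem_annF.mp (annF F).zero_mem)
  | insert a s ha ih =>
    rw [Finset.sum_insert ha, Finset.sum_insert ha, DD_add, Derivation.add_apply, ih]

lemma adj_xy (φ : k →ₗ[ℚ] ℚ) (i : Fin 12) (G H : MvPolynomial (Fin 19 × Fin 19) k) :
    BF (fun q : Fin 19 × Fin 19 => wq q.2) φ (DD (xm k i) G) H =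
      BF (fun q : Fin 19 × Fin 19 => wq q.2) φ G (DD (ym k i) H) := by
  rw [xm, ym, DD_sum, DD_sum, BF_sum_left, BF_sum_right]
  refine Finset.sum_congr rfl fun e _ => ?_
  rw [BF_DD wq wq_pos, wq_ej, div_one]

lemma sum_brackets : ∑ i, (pq i : k) • (xm k i * ym k i - ym k i * xm k i) =
    (-3 : k) • Matrix.diagonal (fun i : Fin 19 => if (i : ℕ) < 4 then (15 : k) else -4) := by
  have h1 : ∀ i : Fin 12, (pq i : k) • (xm k i * ym k i - ym k i * xm k i) =
      ∑ e ∈ Finset.univ.filter (fun e => ei e = i),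
        (Matrix.single (er e) (er e) ((pq (ei e) * wq (er e) : ℚ) : k) -
          Matrix.single (ej e) (ej e) ((pq (ei e) * wq (er e) : ℚ) : k)) := by
    intro i
    rw [xm, ym, split_lemma (eS i) er ej _ (er_inj i) (ej_inj i) er_ne_ej, Finset.smul_sum, eS]
    refine Finset.sum_congr rfl fun e he => ?_
    rw [smul_sub, Matrix.smul_single, Matrix.smul_single, (Finset.mem_filter.mp he).2]
    simp
  rw [Finset.sum_congr rfl fun i _ => h1 i, Finset.sum_fiberwise, Finset.sum_sub_distrib]
  ext a b
  rw [Matrix.sub_apply, Matrix.sum_apply, Matrix.sum_apply, Matrix.smul_apply,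
    Matrix.diagonal_apply]
  by_cases hab : a = b
  · subst hab
    have := congrArg (fun q : ℚ => (q : k)) (wq_sum a)
    push_cast at this
    simp only [Matrix.single_apply, and_self, if_true, smul_eq_mul]
    push_cast
    convert this using 2
    · exact Finset.sum_congr rfl fun e _ => by split_ifs <;> simp
    · exact Finset.sum_congr rfl fun e _ => by split_ifs <;> simp
    · split_ifs <;> simp
  · rw [if_neg hab, smul_zero, Finset.sum_eq_zero, Finset.sum_eq_zero, sub_zero]
    · intro e _
      rw [Matrix.single_apply, if_neg]
      rintro ⟨h, h'⟩; exact hab (h.symm.trans h')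
    · intro e _
      rw [Matrix.single_apply, if_neg]
      rintro ⟨h, h'⟩; exact hab (h.symm.trans h')

lemma edges_mem (F : MvPolynomial (Fin 19 × Fin 19) k) (hx : ∀ i, xm k i ∈ annF F)
    (hd : Matrix.diagonal (fun i : Fin 19 => if (i : ℕ) < 4 then (15 : k) else -4) ∈ annF F)
    (e : Fin 26) : Matrix.single (er e) (ej e) (1 : k) ∈ annF F ∧
      Matrix.single (ej e) (er e) (1 : k) ∈ annF F := by
  have hy : ∀ i, ym k i ∈ annF F := by
    refine positivity_arg wq wq_pos pq pq_pos (xm k) (ym k) F adj_xy hx ?_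
    rw [sum_brackets]
    exact (annF F).smul_mem _ hd
  refine all_edges F (eS (ei e)) er ej (fun e => ((wq (er e) : ℚ) : k)) (er_inj _) (ej_inj _)
    er_ne_ej ?_ ?_ (hx (ei e)) (hy (ei e)) e (by simp [eS])
  · intro a ha b hb hab
    exact wq_inj _ a ha b hb (Rat.cast_injective (α := k) hab)
  · intro e
    exact_mod_cast (wq_pos (er e)).ne'

/-- A path of (undirected) edges from each vertex to vertex `0`. -/
lemma reach : ∀ a : Fin 19, a = 0 ∨
    (∃ e, (er e = a ∧ ej e = 0)) ∨
    (∃ e e', er e = er e' ∧ ej e = a ∧ ej e' = 0) ∨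
    (∃ e e' e'', er e = a ∧ ej e = ej e' ∧ er e' = er e'' ∧ ej e'' = 0) := by
  decide +kernel

lemma all_mem (F : MvPolynomial (Fin 19 × Fin 19) k) (hx : ∀ i, xm k i ∈ annF F)
    (hd : Matrix.diagonal (fun i : Fin 19 => if (i : ℕ) < 4 then (15 : k) else -4) ∈ annF F)
    (a b : Fin 19) (hab : a ≠ b) : Matrix.single a b (1 : k) ∈ annF F := by
  have he := edges_mem F hx hd
  have key : ∀ a : Fin 19, (a = 0 ∨ Matrix.single a 0 (1 : k) ∈ annF F) ∧
      (0 = a ∨ Matrix.single 0 a (1 : k) ∈ annF F) := by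
    intro a
    rcases reach a with h | ⟨e, h1, h2⟩ | ⟨e, e', h1, h2, h3⟩ | ⟨e, e', e'', h1, h2, h3, h4⟩
    · exact ⟨Or.inl h, Or.inl h.symm⟩
    · have := he e
      rw [h1, h2] at this
      exact ⟨Or.inr this.1, Or.inr this.2⟩
    · have t1 := he e
      have t2 := he e'
      rw [h2] at t1
      rw [← h1, h3] at t2
      exact ⟨edge_trans F _ _ _ (Or.inr t1.2) (Or.inr t2.1),
        edge_trans F _ _ _ (Or.inr t2.2) (Or.inr t1.1)⟩
    · have t1 := he e
      have t2 := he e'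
      have t3 := he e''
      rw [h1] at t1
      rw [← h2] at t2
      rw [← h3, h4] at t3
      exact ⟨edge_trans F _ _ _ (Or.inr t1.1) (edge_trans F _ _ _ (Or.inr t2.2) (Or.inr t3.1)),
        edge_trans F _ _ _ (edge_trans F _ _ _ (Or.inr t3.2) (Or.inr t2.1)) (Or.inr t1.2)⟩
  exact (edge_trans F a 0 b (key a).1 (key b).2).resolve_left hab

end concrete3

/-- H is epimorphic in SL₁₉(k): every polynomial function on matrices that is
invariant under right translations by H on SL₁₉(k) is constant on SL₁₉(k). -/
theorem statement1 (k : Type*) [Field k] [IsAlgClosed k] [CharZero k]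
    (f : MvPolynomial (Fin 19 × Fin 19) k)
    (hf : ∀ g : Matrix (Fin 19) (Fin 19) k, g.det = 1 →
      ∀ s : k, s ≠ 0 → ∀ μ : Fin 12 → k,
        MvPolynomial.eval (fun p : Fin 19 × Fin 19 => (g * (dmat k s * hmat k μ)) p.1 p.2) f =
          MvPolynomial.eval (fun p : Fin 19 × Fin 19 => g p.1 p.2) f) :
    ∀ g : Matrix (Fin 19) (Fin 19) k, g.det = 1 →
      MvPolynomial.eval (fun p : Fin 19 × Fin 19 => g p.1 p.2) f =
        MvPolynomial.eval (fun p : Fin 19 × Fin 19 => (1 : Matrix (Fin 19) (Fin 19) k) p.1 p.2) f := by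
  obtain ⟨N, F, hF⟩ := exists_extension (0 : Fin 19) (cM k) f
  have hf' : ∀ g : Matrix (Fin 19) (Fin 19) k, g.det = 1 → ∀ s : k, s ≠ 0 → ∀ μ : Fin 12 → k,
      ev f (g * (dmat k s * hmat k μ)) = ev f g := hf
  -- the auxiliary matrix has determinant one
  have hdet : ∀ g : Matrix (Fin 19) (Fin 19) k, g.det ≠ 0 →
      (Matrix.diagonal (Function.update 1 0 (g.det)⁻¹) * (g * cM k)).det = 1 := by
    intro g hg
    rw [Matrix.det_mul, Matrix.det_mul, det_cM, Matrix.det_diagonal, Finset.prod_update_of_mem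
      (Finset.mem_univ _)]
    simp [hg]
  have hx : ∀ i, xm k i ∈ annF F := by
    intro i
    refine annF_of_inv F _ fun g hg t => ?_
    have hd1 : (g * (1 + t • xm k i)).det = g.det := by
      rw [Matrix.det_mul, ← emb_Nmat, det_one_add_emb, mul_one]
    rw [hF _ (by rwa [hd1]), hF g hg, hd1, mul_assoc g, ← cM_hmat, ← mul_assoc g, ← mul_assoc,
      ← hf' _ (hdet g hg) 1 one_ne_zero (mus (Pi.single i t)), dmat_one, one_mul]
  have hd : Matrix.diagonal (fun i : Fin 19 => if (i : ℕ) < 4 then (15 : k) else -4) ∈ annF F := by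
    refine annF_diag F (fun i : Fin 19 => (i : ℕ) < 4) fun g hg s hs => ?_
    change ev F (g * dmat k s) = _
    have hd1 : (g * dmat k s).det = g.det := by
      rw [Matrix.det_mul, det_dmat s hs, mul_one]
    rw [hF _ (by rwa [hd1]), hF g hg, hd1, mul_assoc g, ← cM_dmat, ← mul_assoc g, ← mul_assoc,
      ← hf' _ (hdet g hg) s hs 0, hmat_zero, mul_one]
  have hconst := const_of_annF F (all_mem F hx hd)
  have hu : IsUnit (cM k).det := by rw [det_cM]; exact isUnit_one
  have hgen : ∀ g : Matrix (Fin 19) (Fin 19) k, g.det = 1 → ev f g = ev F 1 := by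
    intro g hg
    have h1 : (g * (cM k)⁻¹).det = 1 := by
      rw [Matrix.det_mul, Matrix.det_nonsing_inv, det_cM, hg]
      simp
    rw [← hconst _ h1, hF _ (by rw [h1]; exact one_ne_zero), h1, mul_assoc,
      Matrix.nonsing_inv_mul _ hu]
    have : (Function.update (1 : Fin 19 → k) 0 (1 : k)⁻¹) = 1 := by
      rw [inv_one]; exact Function.update_eq_self _ _
    rw [this]
    simp
  intro g hg
  exact (hgen g hg).trans (hgen 1 Matrix.det_one).symm
end
end

section
/- Let F be a subgroup of SL_19(k) containing H such that V = k^19 is a semisimple F-module (i.e., every F-invariant linear subspace of k^19 admits an F-invariant complement). Then V is a simple F-module: the only F-invariant linear subspaces of k^19 are {0} and k^19. -/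
open Matrix

noncomputable section

/-- The nilpotent part of `hmat`, written out. -/
def Tvec (k : Type*) [Field k] (μ : Fin 12 → k) (v : Fin 19 → k) : Fin 19 → k :=
  ![0, 0, 0, 0,
    μ 1 * v 0 + μ 0 * v 1, μ 2 * v 0 + μ 1 * v 1, μ 2 * v 1,
    μ 3 * v 0 + μ 0 * v 2, μ 4 * v 0 + μ 3 * v 2, μ 4 * v 2,
    μ 5 * v 0 + μ 0 * v 3, μ 6 * v 0 + μ 5 * v 3, μ 6 * v 3,
    μ 7 * v 0 + μ 0 * v 1, μ 8 * v 0 + μ 7 * v 1,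
    μ 9 * v 0 + μ 8 * v 2, μ 10 * v 0 + μ 9 * v 2,
    μ 11 * v 0 + μ 10 * v 3, μ 11 * v 3]

/-- The index equivalence, with codomain written as `Fin 19`. -/
def sig : Fin 4 ⊕ Fin 15 ≃ Fin 19 := finSumFinEquiv

lemma hmat_sum (k : Type*) [Field k] (μ : Fin 12 → k) (v : Fin 19 → k) (i : Fin 4 ⊕ Fin 15) :
    (hmat k μ *ᵥ v) (sig i) =
      (Matrix.fromBlocks (1 : Matrix (Fin 4) (Fin 4) k) (0 : Matrix (Fin 4) (Fin 15) k)
      (Mmat k μ) (1 : Matrix (Fin 15) (Fin 15) k) *ᵥ (v ∘ sig)) i := by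
  have h : hmat k μ = Matrix.reindex sig sig
    (Matrix.fromBlocks (1 : Matrix (Fin 4) (Fin 4) k) (0 : Matrix (Fin 4) (Fin 15) k)
      (Mmat k μ) (1 : Matrix (Fin 15) (Fin 15) k)) := rfl
  rw [h, Matrix.reindex_apply, Matrix.submatrix_mulVec_equiv]
  simp

lemma hmat_mulVec (k : Type*) [Field k] (μ : Fin 12 → k) (v : Fin 19 → k) :
    hmat k μ *ᵥ v = v + Tvec k μ v := by
  funext i
  obtain ⟨i, rfl⟩ := sig.surjective i
  rw [hmat_sum, Matrix.fromBlocks_mulVec]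
  rcases i with i | i
  · rw [Sum.elim_inl, Matrix.one_mulVec, Matrix.zero_mulVec, add_zero, Pi.add_apply]
    have h : Tvec k μ v (sig (Sum.inl i)) = 0 := by
      fin_cases i <;> rfl
    rw [h, add_zero]
    rfl
  · rw [Sum.elim_inr, Matrix.one_mulVec, Pi.add_apply, Pi.add_apply, add_comm]
    have h : Tvec k μ v (sig (Sum.inr i)) = (Mmat k μ *ᵥ ((v ∘ sig) ∘ Sum.inl)) i := by
      have e0 : sig (Sum.inl 0) = 0 := rfl
      have e1 : sig (Sum.inl 1) = 1 := rfl
      have e2 : sig (Sum.inl 2) = 2 := rfl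
      have e3 : sig (Sum.inl 3) = 3 := rfl
      simp only [Matrix.mulVec, dotProduct, Fin.sum_univ_four, Function.comp_apply, e0, e1, e2, e3]
      fin_cases i <;> simp [Mmat] <;> rfl
    rw [h]
    rfl

lemma Tvec_zero (k : Type*) [Field k] (v : Fin 19 → k) : Tvec k 0 v = 0 := by
  funext i
  fin_cases i <;> simp [Tvec]

set_option maxHeartbeats 4000000 in
/-- An endomorphism commuting with the group is scalar. -/
lemma scalar_of_commute (k : Type*) [Field k] [CharZero k]
    (P : (Fin 19 → k) →ₗ[k] (Fin 19 → k))
    (hD : ∀ v, P (dmat k 2 *ᵥ v) = dmat k 2 *ᵥ P v)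
    (hT : ∀ μ v, P (Tvec k μ v) = Tvec k μ (P v)) :
    ∃ c : k, ∀ v, P v = c • v := by
  have hlow : ∀ j : Fin 19, (j : ℕ) < 4 → ∀ i : Fin 19, ¬ (i : ℕ) < 4 →
      P (Pi.single j 1) i = 0 := by
    intro j hj i hi
    have h1 : dmat k 2 *ᵥ (Pi.single j 1) = (2 : k) ^ (15 : ℤ) • (Pi.single j 1 : Fin 19 → k) := by
      funext a
      simp only [dmat, Matrix.mulVec_diagonal, Pi.smul_apply, smul_eq_mul]
      by_cases h : a = j
      · subst h; simp [hj]
      · simp [h]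
    have h2 := congrFun (hD (Pi.single j 1)) i
    rw [h1, map_smul] at h2
    simp only [dmat, Matrix.mulVec_diagonal, Pi.smul_apply, smul_eq_mul, hi, if_false] at h2
    have h3 : ((2 : k) ^ (15 : ℤ) - (2 : k) ^ (-4 : ℤ)) * P (Pi.single j 1) i = 0 := by
      rw [sub_mul, h2, sub_self]
    rcases mul_eq_zero.mp h3 with h | h
    · exfalso; norm_num at h
    · exact h
  -- kernel conditions
  have kerT : ∀ μ v, Tvec k μ v = 0 → Tvec k μ (P v) = 0 := by
    intro μ v h
    rw [← hT, h, map_zero]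
  have z01 : P (Pi.single 0 1) 1 = 0 := by
    have h := congrFun (kerT (Pi.single 0 1) (Pi.single 0 1) (by
      funext i
      fin_cases i <;> simp [Tvec])) 4
    simpa [Tvec] using h
  have z02 : P (Pi.single 0 1) 2 = 0 := by
    have h := congrFun (kerT (Pi.single 0 1) (Pi.single 0 1) (by
      funext i
      fin_cases i <;> simp [Tvec])) 7
    simpa [Tvec] using h
  have z03 : P (Pi.single 0 1) 3 = 0 := by
    have h := congrFun (kerT (Pi.single 0 1) (Pi.single 0 1) (by
      funext i
      fin_cases i <;> simp [Tvec])) 10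
    simpa [Tvec] using h
  have z10 : P (Pi.single 1 1) 0 = 0 := by
    have h := congrFun (kerT (Pi.single 4 1) (Pi.single 1 1) (by
      funext i
      fin_cases i <;> simp [Tvec])) 8
    simpa [Tvec] using h
  have z12 : P (Pi.single 1 1) 2 = 0 := by
    have h := congrFun (kerT (Pi.single 4 1) (Pi.single 1 1) (by
      funext i
      fin_cases i <;> simp [Tvec])) 9
    simpa [Tvec] using h
  have z13 : P (Pi.single 1 1) 3 = 0 := by
    have h := congrFun (kerT (Pi.single 6 1) (Pi.single 1 1) (by
      funext i
      fin_cases i <;> simp [Tvec])) 12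
    simpa [Tvec] using h
  have z20 : P (Pi.single 2 1) 0 = 0 := by
    have h := congrFun (kerT (Pi.single 2 1) (Pi.single 2 1) (by
      funext i
      fin_cases i <;> simp [Tvec])) 5
    simpa [Tvec] using h
  have z21 : P (Pi.single 2 1) 1 = 0 := by
    have h := congrFun (kerT (Pi.single 2 1) (Pi.single 2 1) (by
      funext i
      fin_cases i <;> simp [Tvec])) 6
    simpa [Tvec] using h
  have z23 : P (Pi.single 2 1) 3 = 0 := by
    have h := congrFun (kerT (Pi.single 6 1) (Pi.single 2 1) (by
      funext i
      fin_cases i <;> simp [Tvec])) 12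
    simpa [Tvec] using h
  have z30 : P (Pi.single 3 1) 0 = 0 := by
    have h := congrFun (kerT (Pi.single 2 1) (Pi.single 3 1) (by
      funext i
      fin_cases i <;> simp [Tvec])) 5
    simpa [Tvec] using h
  have z31 : P (Pi.single 3 1) 1 = 0 := by
    have h := congrFun (kerT (Pi.single 2 1) (Pi.single 3 1) (by
      funext i
      fin_cases i <;> simp [Tvec])) 6
    simpa [Tvec] using h
  have z32 : P (Pi.single 3 1) 2 = 0 := by
    have h := congrFun (kerT (Pi.single 4 1) (Pi.single 3 1) (by
      funext i
      fin_cases i <;> simp [Tvec])) 9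
    simpa [Tvec] using h
  have expand : ∀ j : Fin 19, (j : ℕ) < 4 → (∀ i : Fin 19, (i : ℕ) < 4 → i ≠ j →
      P (Pi.single j 1) i = 0) →
      P (Pi.single j 1) = P (Pi.single j 1) j • (Pi.single j 1 : Fin 19 → k) := by
    intro j hj h
    funext i
    by_cases hij : i = j
    · subst hij; simp
    · by_cases hi : (i : ℕ) < 4
      · simp [h i hi hij, hij]
      · simp [hlow j hj i hi, hij]
  have p0 := expand 0 (by decide) (by
    intro i hi hne
    have : i = 0 ∨ i = 1 ∨ i = 2 ∨ i = 3 := by omega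
    rcases this with rfl | rfl | rfl | rfl <;> first | exact absurd rfl hne | assumption)
  have p1 := expand 1 (by decide) (by
    intro i hi hne
    have : i = 0 ∨ i = 1 ∨ i = 2 ∨ i = 3 := by omega
    rcases this with rfl | rfl | rfl | rfl <;> first | exact absurd rfl hne | assumption)
  have p2 := expand 2 (by decide) (by
    intro i hi hne
    have : i = 0 ∨ i = 1 ∨ i = 2 ∨ i = 3 := by omega
    rcases this with rfl | rfl | rfl | rfl <;> first | exact absurd rfl hne | assumption)
  have p3 := expand 3 (by decide) (by
    intro i hi hne
    have : i = 0 ∨ i = 1 ∨ i = 2 ∨ i = 3 := by omega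
    rcases this with rfl | rfl | rfl | rfl <;> first | exact absurd rfl hne | assumption)
  have Tsm : ∀ μ (c : k) v, Tvec k μ (c • v) = c • Tvec k μ v := by
    intro μ c v
    funext i
    fin_cases i <;> simp [Tvec] <;> ring
  have step : ∀ (m : Fin 12) (j b : Fin 19) (c : k),
      P (Pi.single j 1) = c • (Pi.single j 1 : Fin 19 → k) →
      Tvec k (Pi.single m 1) (Pi.single j 1) = (Pi.single b 1 : Fin 19 → k) →
      P (Pi.single b 1) = c • (Pi.single b 1 : Fin 19 → k) := by
    intro m j b c h1 h2
    rw [← h2, hT, h1, Tsm]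
  have uniq : ∀ (b : Fin 19) (c d : k), P (Pi.single b 1) = c • (Pi.single b 1 : Fin 19 → k) →
      P (Pi.single b 1) = d • (Pi.single b 1 : Fin 19 → k) → c = d := by
    intro b c d h1 h2
    have := congrFun (h1.symm.trans h2) b
    simpa using this
  have p5 := step 2 0 5 _ p0 (by
    funext i
    fin_cases i <;> simp [Tvec])
  have p8 := step 4 0 8 _ p0 (by
    funext i
    fin_cases i <;> simp [Tvec])
  have p11 := step 6 0 11 _ p0 (by
    funext i
    fin_cases i <;> simp [Tvec])
  have q5 := step 1 1 5 _ p1 (by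
    funext i
    fin_cases i <;> simp [Tvec])
  rw [uniq _ _ _ q5 p5] at p1
  have q8 := step 3 2 8 _ p2 (by
    funext i
    fin_cases i <;> simp [Tvec])
  rw [uniq _ _ _ q8 p8] at p2
  have q11 := step 5 3 11 _ p3 (by
    funext i
    fin_cases i <;> simp [Tvec])
  rw [uniq _ _ _ q11 p11] at p3
  have p4 := step 1 0 4 _ p0 (by
    funext i
    fin_cases i <;> simp [Tvec])
  have p6 := step 2 1 6 _ p1 (by
    funext i
    fin_cases i <;> simp [Tvec])
  have p7 := step 3 0 7 _ p0 (by
    funext i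
    fin_cases i <;> simp [Tvec])
  have p9 := step 4 2 9 _ p2 (by
    funext i
    fin_cases i <;> simp [Tvec])
  have p10 := step 5 0 10 _ p0 (by
    funext i
    fin_cases i <;> simp [Tvec])
  have p12 := step 6 3 12 _ p3 (by
    funext i
    fin_cases i <;> simp [Tvec])
  have p13 := step 7 0 13 _ p0 (by
    funext i
    fin_cases i <;> simp [Tvec])
  have p14 := step 8 0 14 _ p0 (by
    funext i
    fin_cases i <;> simp [Tvec])
  have p15 := step 9 0 15 _ p0 (by
    funext i
    fin_cases i <;> simp [Tvec])
  have p16 := step 10 0 16 _ p0 (by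
    funext i
    fin_cases i <;> simp [Tvec])
  have p17 := step 11 0 17 _ p0 (by
    funext i
    fin_cases i <;> simp [Tvec])
  have p18 := step 11 3 18 _ p3 (by
    funext i
    fin_cases i <;> simp [Tvec])
  refine ⟨P (Pi.single 0 1) 0, ?_⟩
  have hall : P = P (Pi.single 0 1) 0 • LinearMap.id := by
    apply LinearMap.pi_ext'
    intro i
    apply LinearMap.ext_ring
    simp only [LinearMap.comp_apply, LinearMap.single_apply, LinearMap.smul_apply,
      LinearMap.id_apply]
    fin_cases i
    · exact p0
    · exact p1
    · exact p2
    · exact p3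
    · exact p4
    · exact p5
    · exact p6
    · exact p7
    · exact p8
    · exact p9
    · exact p10
    · exact p11
    · exact p12
    · exact p13
    · exact p14
    · exact p15
    · exact p16
    · exact p17
    · exact p18
  intro v
  exact congrArg (fun f : (Fin 19 → k) →ₗ[k] (Fin 19 → k) => f v) hall

/-- If F is a subgroup of SL₁₉(k) containing H and V = k¹⁹ is a semisimple F-module,
then V is a simple F-module. -/
theorem statement2 (k : Type*) [Field k] [IsAlgClosed k] [CharZero k]
    (F : Set (Matrix (Fin 19) (Fin 19) k))
    (hdet : ∀ g ∈ F, g.det = 1)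
    (hone : (1 : Matrix (Fin 19) (Fin 19) k) ∈ F)
    (hmul : ∀ a ∈ F, ∀ b ∈ F, a * b ∈ F)
    (hinv : ∀ a ∈ F, a⁻¹ ∈ F)
    (hH : ∀ s : k, s ≠ 0 → ∀ μ : Fin 12 → k, dmat k s * hmat k μ ∈ F)
    (hss : ∀ W : Submodule k (Fin 19 → k),
      (∀ g ∈ F, ∀ w ∈ W, g.mulVec w ∈ W) →
      ∃ W' : Submodule k (Fin 19 → k),
        (∀ g ∈ F, ∀ w ∈ W', g.mulVec w ∈ W') ∧ IsCompl W W') :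
    ∀ W : Submodule k (Fin 19 → k),
      (∀ g ∈ F, ∀ w ∈ W, g.mulVec w ∈ W) → W = ⊥ ∨ W = ⊤ := by
  intro W hW
  obtain ⟨W', hW', hc⟩ := hss W hW
  have hcomm : ∀ g ∈ F, ∀ v, W.projection W' hc (g *ᵥ v) = g *ᵥ W.projection W' hc v := by
    intro g hg v
    have hv : v = W.projection W' hc v + W'.projection W hc.symm v := by
      rw [Submodule.projection_add_projection_eq_self]
    have h1 : g *ᵥ W.projection W' hc v ∈ W := hW g hg _ (Submodule.projection_apply_mem hc v)
    have h2 : g *ᵥ W'.projection W hc.symm v ∈ W' :=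
      hW' g hg _ (Submodule.projection_apply_mem hc.symm v)
    conv_lhs => rw [hv, Matrix.mulVec_add, map_add]
    rw [(Submodule.projection_eq_self_iff hc _).2 h1,
      (Submodule.projection_apply_eq_zero_iff hc).2 h2, add_zero]
  have hd1 : dmat k 1 = 1 := by
    simp [dmat]
  have hh0 : hmat k 0 = 1 := by
    apply Matrix.ext_of_mulVec_single
    intro i
    rw [hmat_mulVec, Tvec_zero, add_zero, Matrix.one_mulVec]
  obtain ⟨c, hP⟩ := scalar_of_commute k (W.projection W' hc)
    (by
      intro v
      apply hcomm
      have := hH 2 two_ne_zero 0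
      rwa [hh0, mul_one] at this)
    (by
      intro μ v
      have hm := hH 1 one_ne_zero μ
      rw [hd1, one_mul] at hm
      have := hcomm _ hm v
      rw [hmat_mulVec, hmat_mulVec, map_add] at this
      exact add_left_cancel this)
  by_cases h0 : c = 0
  · left
    rw [eq_bot_iff]
    intro w hw
    have h1 := (Submodule.projection_eq_self_iff hc w).2 hw
    rw [hP, h0, zero_smul] at h1
    simp [← h1]
  · right
    rw [eq_top_iff]
    intro w _
    have h1 := Submodule.projection_apply_mem hc w
    rw [hP] at h1
    exact (Submodule.smul_mem_iff W h0).1 h1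
end
end

section
/- For every w = (a_1, a_2, a_3, a_4) ∈ k^4 with all four coordinates a_1, a_2, a_3, a_4 nonzero, the linear map φ_w : k^12 → k^15 defined by φ_w(μ̄) = M(μ̄)·w is injective (equivalently, its image has dimension 12). -/
open Matrix

noncomputable section

/-- If all four coordinates of w are nonzero, then φ_w : μ̄ ↦ M(μ̄)·w is injective. -/
theorem statement6 (k : Type*) [Field k] [IsAlgClosed k] [CharZero k]
    (w : Fin 4 → k) (hw : ∀ j : Fin 4, w j ≠ 0) :
    Function.Injective (fun μ : Fin 12 → k => (Mmat k μ).mulVec w) := by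
  intro μ ν h
  have h0 := hw 0
  have h1 := hw 1
  have h2 := hw 2
  have h3 := hw 3
  have e : ∀ i : Fin 15, (Mmat k μ).mulVec w i = (Mmat k ν).mulVec w i :=
    fun i => congrFun h i
  have r0 := e 0
  have r1 := e 1
  have r2 := e 2
  have r3 := e 3
  have r4 := e 4
  have r5 := e 5
  have r6 := e 6
  have r7 := e 7
  have r8 := e 8
  have r9 := e 9
  have r10 := e 10
  have r11 := e 11
  have r12 := e 12
  have r13 := e 13
  have r14 := e 14
  simp [Mmat, Matrix.mulVec, dotProduct, Fin.sum_univ_four, h0, h1, h2, h3] at r0 r1 r2 r3 r4 r5 r6 r7 r8 r9 r10 r11 r12 r13 r14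
  have m1 : μ 1 = ν 1 := by
    rw [r2] at r1
    exact mul_right_cancel₀ h1 (by linear_combination r1)
  have m0 : μ 0 = ν 0 := by
    rw [m1] at r0
    exact mul_right_cancel₀ h1 (by linear_combination r0)
  have m3 : μ 3 = ν 3 := by
    rw [r5] at r4
    exact mul_right_cancel₀ h2 (by linear_combination r4)
  have m5 : μ 5 = ν 5 := by
    rw [r8] at r7
    exact mul_right_cancel₀ h3 (by linear_combination r7)
  have m7 : μ 7 = ν 7 := by
    rw [m0] at r9
    exact mul_right_cancel₀ h0 (by linear_combination r9)
  have m8 : μ 8 = ν 8 := by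
    rw [m7] at r10
    exact mul_right_cancel₀ h0 (by linear_combination r10)
  have m10 : μ 10 = ν 10 := by
    rw [r14] at r13
    exact mul_right_cancel₀ h3 (by linear_combination r13)
  have m9 : μ 9 = ν 9 := by
    rw [m10] at r12
    exact mul_right_cancel₀ h2 (by linear_combination r12)
  funext i
  fin_cases i
  · exact m0
  · exact m1
  · exact r2
  · exact m3
  · exact r5
  · exact m5
  · exact r8
  · exact m7
  · exact m8
  · exact m9
  · exact m10
  · exact r14
end
end

section
/- For every w = (a_1, a_2, a_3, a_4) ∈ k^4 with at least three of the coordinates a_1, a_2, a_3, a_4 nonzero, the linear map φ_w : k^12 → k^15 defined by φ_w(μ̄) = M(μ̄)·w is injective (equivalently, its image has dimension 12). -/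
open Matrix

noncomputable section

/-- The kernel of φ_w is trivial. -/
lemma kernel_trivial {k : Type*} [Field k] (a b c d : k)
    (h : (a = 0 ∧ b ≠ 0 ∧ c ≠ 0 ∧ d ≠ 0) ∨ (a ≠ 0 ∧ (b ≠ 0 ∨ c ≠ 0 ∨ d ≠ 0)))
    (m : Fin 12 → k) (hm : (Mmat k m).mulVec ![a, b, c, d] = 0) : m = 0 := by
  have e : ∀ i, (Mmat k m).mulVec ![a, b, c, d] i = 0 := fun i => by rw [hm]; rfl
  have e0 : m 1 * a + m 0 * b = 0 := by
    have := e 0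
    simp only [mulVec, dotProduct, Fin.sum_univ_four] at this
    change m 1 * a + m 0 * b + 0 * c + 0 * d = 0 at this
    linear_combination this
  have e1 : m 2 * a + m 1 * b = 0 := by
    have := e 1
    simp only [mulVec, dotProduct, Fin.sum_univ_four] at this
    change m 2 * a + m 1 * b + 0 * c + 0 * d = 0 at this
    linear_combination this
  have e2 : m 2 * b = 0 := by
    have := e 2
    simp only [mulVec, dotProduct, Fin.sum_univ_four] at this
    change 0 * a + m 2 * b + 0 * c + 0 * d = 0 at this
    linear_combination this
  have e3 : m 3 * a + m 0 * c = 0 := by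
    have := e 3
    simp only [mulVec, dotProduct, Fin.sum_univ_four] at this
    change m 3 * a + 0 * b + m 0 * c + 0 * d = 0 at this
    linear_combination this
  have e4 : m 4 * a + m 3 * c = 0 := by
    have := e 4
    simp only [mulVec, dotProduct, Fin.sum_univ_four] at this
    change m 4 * a + 0 * b + m 3 * c + 0 * d = 0 at this
    linear_combination this
  have e5 : m 4 * c = 0 := by
    have := e 5
    simp only [mulVec, dotProduct, Fin.sum_univ_four] at this
    change 0 * a + 0 * b + m 4 * c + 0 * d = 0 at this
    linear_combination this
  have e6 : m 5 * a + m 0 * d = 0 := by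
    have := e 6
    simp only [mulVec, dotProduct, Fin.sum_univ_four] at this
    change m 5 * a + 0 * b + 0 * c + m 0 * d = 0 at this
    linear_combination this
  have e7 : m 6 * a + m 5 * d = 0 := by
    have := e 7
    simp only [mulVec, dotProduct, Fin.sum_univ_four] at this
    change m 6 * a + 0 * b + 0 * c + m 5 * d = 0 at this
    linear_combination this
  have e8 : m 6 * d = 0 := by
    have := e 8
    simp only [mulVec, dotProduct, Fin.sum_univ_four] at this
    change 0 * a + 0 * b + 0 * c + m 6 * d = 0 at this
    linear_combination this
  have e9 : m 7 * a + m 0 * b = 0 := by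
    have := e 9
    simp only [mulVec, dotProduct, Fin.sum_univ_four] at this
    change m 7 * a + m 0 * b + 0 * c + 0 * d = 0 at this
    linear_combination this
  have e10 : m 8 * a + m 7 * b = 0 := by
    have := e 10
    simp only [mulVec, dotProduct, Fin.sum_univ_four] at this
    change m 8 * a + m 7 * b + 0 * c + 0 * d = 0 at this
    linear_combination this
  have e11 : m 9 * a + m 8 * c = 0 := by
    have := e 11
    simp only [mulVec, dotProduct, Fin.sum_univ_four] at this
    change m 9 * a + 0 * b + m 8 * c + 0 * d = 0 at this
    linear_combination this
  have e12 : m 10 * a + m 9 * c = 0 := by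
    have := e 12
    simp only [mulVec, dotProduct, Fin.sum_univ_four] at this
    change m 10 * a + 0 * b + m 9 * c + 0 * d = 0 at this
    linear_combination this
  have e13 : m 11 * a + m 10 * d = 0 := by
    have := e 13
    simp only [mulVec, dotProduct, Fin.sum_univ_four] at this
    change m 11 * a + 0 * b + 0 * c + m 10 * d = 0 at this
    linear_combination this
  have e14 : m 11 * d = 0 := by
    have := e 14
    simp only [mulVec, dotProduct, Fin.sum_univ_four] at this
    change 0 * a + 0 * b + 0 * c + m 11 * d = 0 at this
    linear_combination this
  clear e hm
  have key : m 0 = 0 ∧ m 1 = 0 ∧ m 2 = 0 ∧ m 3 = 0 ∧ m 4 = 0 ∧ m 5 = 0 ∧ m 6 = 0 ∧ m 7 = 0 ∧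
      m 8 = 0 ∧ m 9 = 0 ∧ m 10 = 0 ∧ m 11 = 0 := by
    rcases h with ⟨rfl, hb, hc, hd⟩ | ⟨ha, h⟩
    · simp_all
    · have h0 : m 0 = 0 := by
        rcases h with hb | hc | hd <;> simp_all
      simp_all
  obtain ⟨h0, h1, h2, h3, h4, h5, h6, h7, h8, h9, h10, h11⟩ := key
  funext i
  fin_cases i <;> assumption

/-- If at least three coordinates of w are nonzero, then φ_w : μ̄ ↦ M(μ̄)·w is injective. -/
theorem statement7 (k : Type*) [Field k] [IsAlgClosed k] [CharZero k]
    (w : Fin 4 → k) (J : Finset (Fin 4)) (hJ : 3 ≤ J.card) (hw : ∀ j ∈ J, w j ≠ 0) :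
    Function.Injective (fun μ : Fin 12 → k => (Mmat k μ).mulVec w) := by
  have h : (w 0 = 0 ∧ w 1 ≠ 0 ∧ w 2 ≠ 0 ∧ w 3 ≠ 0) ∨
      (w 0 ≠ 0 ∧ (w 1 ≠ 0 ∨ w 2 ≠ 0 ∨ w 3 ≠ 0)) := by
    have comb : ∀ J : Finset (Fin 4), 3 ≤ J.card →
        (1 ∈ J ∧ 2 ∈ J ∧ 3 ∈ J) ∨ (0 ∈ J ∧ (1 ∈ J ∨ 2 ∈ J)) := by decide
    have g0 := hw 0
    have g1 := hw 1
    have g2 := hw 2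
    have g3 := hw 3
    have := comb J hJ
    tauto
  have hwe : w = ![w 0, w 1, w 2, w 3] := by
    funext i
    fin_cases i <;> rfl
  intro x y hxy
  have hsub : Mmat k (x - y) = Mmat k x - Mmat k y := by
    ext i j
    fin_cases i <;> fin_cases j <;> simp [Mmat]
  have hker := kernel_trivial (w 0) (w 1) (w 2) (w 3) h (x - y) (by
    rw [← hwe, hsub, sub_mulVec]
    exact sub_eq_zero.mpr hxy)
  exact sub_eq_zero.mp hker
end
end

section
/- For every w = (a_1, a_2, a_3, a_4) ∈ k^4 with at least two of the coordinates a_1, a_2, a_3, a_4 nonzero, the image of the linear map φ_w : k^12 → k^15, φ_w(μ̄) = M(μ̄)·w, has dimension at least 8. -/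
open Matrix

noncomputable section

set_option maxHeartbeats 2000000 in
/-- The linear map `μ ↦ M(μ) w`. -/
def phiW (k : Type*) [Field k] (w : Fin 4 → k) : (Fin 12 → k) →ₗ[k] (Fin 15 → k) where
  toFun μ := (Mmat k μ).mulVec w
  map_add' x y := by
    ext i
    fin_cases i <;> simp [Mmat, Matrix.mulVec, dotProduct, Fin.sum_univ_four] <;> ring
  map_smul' c x := by
    ext i
    fin_cases i <;> simp [Mmat, Matrix.mulVec, dotProduct, Fin.sum_univ_four] <;> ring

theorem rank_of_free (k : Type*) [Field k] (w : Fin 4 → k) (t : Fin 4 → Fin 12)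
    (h : ∀ μ : Fin 12 → k, (Mmat k μ).mulVec w = 0 → (∀ i, μ (t i) = 0) → μ = 0) :
    8 ≤ Module.finrank k
      (Submodule.span k (Set.range fun μ : Fin 12 → k => (Mmat k μ).mulVec w)) := by
  have h1 : Submodule.span k (Set.range fun μ : Fin 12 → k => (Mmat k μ).mulVec w)
      = LinearMap.range (phiW k w) := by
    rw [← Submodule.span_eq (LinearMap.range (phiW k w))]
    rfl
  rw [h1]
  have h2 := LinearMap.finrank_range_add_finrank_ker (phiW k w)
  have h3 : Function.Injective
      ((LinearMap.funLeft k k t).comp (LinearMap.ker (phiW k w)).subtype) := by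
    rw [← LinearMap.ker_eq_bot, LinearMap.ker_eq_bot']
    rintro ⟨μ, hμ⟩ h0
    apply Subtype.ext
    exact h μ hμ (fun i => congrFun h0 i)
  have h4 := LinearMap.finrank_le_finrank_of_injective h3
  simp only [Module.finrank_fin_fun] at h2 h4
  omega

theorem rows_of_zero (k : Type*) [Field k] (w : Fin 4 → k) (μ : Fin 12 → k)
    (h : (Mmat k μ).mulVec w = 0) :
    (μ 1 * w 0 + μ 0 * w 1 = 0 ∧ μ 2 * w 0 + μ 1 * w 1 = 0 ∧ μ 2 * w 1 = 0) ∧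
    (μ 3 * w 0 + μ 0 * w 2 = 0 ∧ μ 4 * w 0 + μ 3 * w 2 = 0 ∧ μ 4 * w 2 = 0) ∧
    (μ 5 * w 0 + μ 0 * w 3 = 0 ∧ μ 6 * w 0 + μ 5 * w 3 = 0 ∧ μ 6 * w 3 = 0) ∧
    (μ 7 * w 0 + μ 0 * w 1 = 0 ∧ μ 8 * w 0 + μ 7 * w 1 = 0 ∧ μ 9 * w 0 + μ 8 * w 2 = 0) ∧
    (μ 10 * w 0 + μ 9 * w 2 = 0 ∧ μ 11 * w 0 + μ 10 * w 3 = 0 ∧ μ 11 * w 3 = 0) := by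
  refine ⟨⟨?_, ?_, ?_⟩, ⟨?_, ?_, ?_⟩, ⟨?_, ?_, ?_⟩, ⟨?_, ?_, ?_⟩, ⟨?_, ?_, ?_⟩⟩
  · simpa [Mmat, Matrix.mulVec, dotProduct, Fin.sum_univ_four] using congrFun h 0
  · simpa [Mmat, Matrix.mulVec, dotProduct, Fin.sum_univ_four] using congrFun h 1
  · simpa [Mmat, Matrix.mulVec, dotProduct, Fin.sum_univ_four] using congrFun h 2
  · simpa [Mmat, Matrix.mulVec, dotProduct, Fin.sum_univ_four] using congrFun h 3
  · simpa [Mmat, Matrix.mulVec, dotProduct, Fin.sum_univ_four] using congrFun h 4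
  · simpa [Mmat, Matrix.mulVec, dotProduct, Fin.sum_univ_four] using congrFun h 5
  · simpa [Mmat, Matrix.mulVec, dotProduct, Fin.sum_univ_four] using congrFun h 6
  · simpa [Mmat, Matrix.mulVec, dotProduct, Fin.sum_univ_four] using congrFun h 7
  · simpa [Mmat, Matrix.mulVec, dotProduct, Fin.sum_univ_four] using congrFun h 8
  · simpa [Mmat, Matrix.mulVec, dotProduct, Fin.sum_univ_four] using congrFun h 9
  · simpa [Mmat, Matrix.mulVec, dotProduct, Fin.sum_univ_four] using congrFun h 10
  · simpa [Mmat, Matrix.mulVec, dotProduct, Fin.sum_univ_four] using congrFun h 11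
  · simpa [Mmat, Matrix.mulVec, dotProduct, Fin.sum_univ_four] using congrFun h 12
  · simpa [Mmat, Matrix.mulVec, dotProduct, Fin.sum_univ_four] using congrFun h 13
  · simpa [Mmat, Matrix.mulVec, dotProduct, Fin.sum_univ_four] using congrFun h 14

theorem cases_J (J : Finset (Fin 4)) (hJ : 2 ≤ J.card) :
    0 ∈ J ∨ (1 ∈ J ∧ 2 ∈ J) ∨ (1 ∈ J ∧ 3 ∈ J) ∨ (2 ∈ J ∧ 3 ∈ J) := by
  revert J
  decide

/-- If at least two coordinates of w are nonzero, then the image of φ_w has dimension ≥ 8. -/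
theorem statement8 (k : Type*) [Field k] [IsAlgClosed k] [CharZero k]
    (w : Fin 4 → k) (J : Finset (Fin 4)) (hJ : 2 ≤ J.card) (hw : ∀ j ∈ J, w j ≠ 0) :
    8 ≤ Module.finrank k
      (Submodule.span k (Set.range fun μ : Fin 12 → k => (Mmat k μ).mulVec w)) := by
  have key : w 0 ≠ 0 ∨ (w 0 = 0 ∧ w 1 ≠ 0 ∧ w 2 ≠ 0) ∨ (w 0 = 0 ∧ w 1 ≠ 0 ∧ w 3 ≠ 0) ∨
      (w 0 = 0 ∧ w 2 ≠ 0 ∧ w 3 ≠ 0) := by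
    by_cases h0 : w 0 = 0
    · rcases cases_J J hJ with h | ⟨h, h'⟩ | ⟨h, h'⟩ | ⟨h, h'⟩
      · exact absurd h0 (hw 0 h)
      · exact Or.inr (Or.inl ⟨h0, hw _ h, hw _ h'⟩)
      · exact Or.inr (Or.inr (Or.inl ⟨h0, hw _ h, hw _ h'⟩))
      · exact Or.inr (Or.inr (Or.inr ⟨h0, hw _ h, hw _ h'⟩))
    · exact Or.inl h0
  rcases key with h0 | ⟨h0, h1, h2⟩ | ⟨h0, h1, h2⟩ | ⟨h0, h1, h2⟩
  · apply rank_of_free k w ![0, 0, 0, 0]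
    intro μ hμ ht
    obtain ⟨⟨r0, r1, r2⟩, ⟨r3, r4, r5⟩, ⟨r6, r7, r8⟩, ⟨r9, r10, r11⟩, ⟨r12, r13, r14⟩⟩ :=
      rows_of_zero k w μ hμ
    have t0 : μ 0 = 0 := ht 0
    have m1 : μ 1 = 0 := by simpa [t0, h0] using r0
    have m2 : μ 2 = 0 := by simpa [m1, h0] using r1
    have m3 : μ 3 = 0 := by simpa [t0, h0] using r3
    have m4 : μ 4 = 0 := by simpa [m3, h0] using r4
    have m5 : μ 5 = 0 := by simpa [t0, h0] using r6
    have m6 : μ 6 = 0 := by simpa [m5, h0] using r7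
    have m7 : μ 7 = 0 := by simpa [t0, h0] using r9
    have m8 : μ 8 = 0 := by simpa [m7, h0] using r10
    have m9 : μ 9 = 0 := by simpa [m8, h0] using r11
    have m10 : μ 10 = 0 := by simpa [m9, h0] using r12
    have m11 : μ 11 = 0 := by simpa [m10, h0] using r13
    ext i
    fin_cases i <;> assumption
  · apply rank_of_free k w ![5, 6, 10, 11]
    intro μ hμ ht
    have := rows_of_zero k w μ hμ
    have t0 : μ 5 = 0 := ht 0
    have t1 : μ 6 = 0 := ht 1
    have t2 : μ 10 = 0 := ht 2
    have t3 : μ 11 = 0 := ht 3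
    simp [h0, h1, h2] at this
    ext i
    fin_cases i <;> simp <;> tauto
  · apply rank_of_free k w ![3, 4, 8, 9]
    intro μ hμ ht
    have := rows_of_zero k w μ hμ
    have t0 : μ 3 = 0 := ht 0
    have t1 : μ 4 = 0 := ht 1
    have t2 : μ 8 = 0 := ht 2
    have t3 : μ 9 = 0 := ht 3
    simp [h0, h1, h2] at this
    ext i
    fin_cases i <;> simp <;> tauto
  · apply rank_of_free k w ![1, 2, 7, 7]
    intro μ hμ ht
    have := rows_of_zero k w μ hμ
    have t0 : μ 1 = 0 := ht 0
    have t1 : μ 2 = 0 := ht 1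
    have t2 : μ 7 = 0 := ht 2
    simp [h0, h1, h2] at this
    ext i
    fin_cases i <;> simp <;> tauto
end
end

section
/- For every nonzero w = (a_1, a_2, a_3, a_4) ∈ k^4, the image of the linear map φ_w : k^12 → k^15, φ_w(μ̄) = M(μ̄)·w, has dimension at least 4. -/
open Matrix

noncomputable section

theorem aux9 (k : Type*) [Field k] (w : Fin 4 → k) (a : k) (ha : a ≠ 0)
    (c : Fin 4 → Fin 12) (r : Fin 4 → Fin 15)
    (h : ∀ i j, ((Mmat k (Pi.single (c i) 1)).mulVec w) (r j) = if i = j then a else 0) :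
    4 ≤ Module.finrank k
      (Submodule.span k (Set.range fun μ : Fin 12 → k => (Mmat k μ).mulVec w)) := by
  have hli : LinearIndependent k
      (fun i : Fin 4 => (Mmat k (Pi.single (c i) 1)).mulVec w) := by
    rw [Fintype.linearIndependent_iff]
    intro g hg j
    have := congrFun hg (r j)
    simp only [Finset.sum_apply, Pi.smul_apply, h, smul_eq_mul, Pi.zero_apply] at this
    simpa [ha] using this
  have h1 := finrank_span_eq_card hli
  rw [Fintype.card_fin] at h1
  refine h1.symm.le.trans ?_
  apply Submodule.finrank_mono
  apply Submodule.span_mono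
  rintro _ ⟨i, rfl⟩
  exact ⟨_, rfl⟩

/-- For every nonzero w ∈ k⁴, the image of φ_w has dimension ≥ 4. -/
theorem statement9 (k : Type*) [Field k] [IsAlgClosed k] [CharZero k]
    (w : Fin 4 → k) (hw : w ≠ 0) :
    4 ≤ Module.finrank k
      (Submodule.span k (Set.range fun μ : Fin 12 → k => (Mmat k μ).mulVec w)) := by
  by_cases h0 : w 0 ≠ 0
  · exact aux9 k w (w 0) h0 ![1, 3, 5, 7] ![0, 3, 6, 9] (by
      intro i j
      fin_cases i <;> fin_cases j <;>
        simp [Mmat, Matrix.mulVec, dotProduct, Fin.sum_univ_four, *])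
  rw [not_not] at h0
  by_cases h1 : w 1 ≠ 0
  · exact aux9 k w (w 1) h1 ![0, 1, 2, 7] ![0, 1, 2, 10] (by
      intro i j
      fin_cases i <;> fin_cases j <;>
        simp [Mmat, Matrix.mulVec, dotProduct, Fin.sum_univ_four, *])
  rw [not_not] at h1
  by_cases h2 : w 2 ≠ 0
  · exact aux9 k w (w 2) h2 ![0, 3, 4, 8] ![3, 4, 5, 11] (by
      intro i j
      fin_cases i <;> fin_cases j <;>
        simp [Mmat, Matrix.mulVec, dotProduct, Fin.sum_univ_four, *])
  rw [not_not] at h2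
  have h3 : w 3 ≠ 0 := by
    intro h3
    apply hw
    funext i
    fin_cases i <;> simp [*]
  exact aux9 k w (w 3) h3 ![0, 5, 6, 10] ![6, 7, 8, 13] (by
      intro i j
      fin_cases i <;> fin_cases j <;>
        simp [Mmat, Matrix.mulVec, dotProduct, Fin.sum_univ_four, *])
end
end

section
/- The columns of the matrices M(μ̄) span all of k^15: the linear span of the set {M(μ̄)·e_j : μ̄ ∈ k^12, j ∈ {1,2,3,4}} (where e_1, e_2, e_3, e_4 is the standard basis of k^4) equals k^15. Equivalently, Im φ_{e_1} + Im φ_{e_2} + Im φ_{e_3} + Im φ_{e_4} = k^15. -/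
open Matrix

noncomputable section

/-- The columns of the matrices M(μ̄) span all of k¹⁵. -/
theorem statement12 (k : Type*) [Field k] [IsAlgClosed k] [CharZero k] :
    Submodule.span k {v : Fin 15 → k |
      ∃ (μ : Fin 12 → k) (j : Fin 4), v = (Mmat k μ).mulVec (Pi.single j 1)} = ⊤ := by
  have key : ∀ i : Fin 15, ∃ (a : Fin 12) (j : Fin 4),
      (Pi.single i 1 : Fin 15 → k) = (Mmat k (Pi.single a 1)).mulVec (Pi.single j 1) := by
    intro i
    refine ⟨![1, 2, 2, 3, 4, 4, 5, 6, 6, 7, 8, 9, 10, 11, 11] i,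
      ![0, 0, 1, 0, 0, 2, 0, 0, 3, 0, 0, 0, 0, 0, 3] i, ?_⟩
    rw [Matrix.mulVec_single_one]
    ext r
    fin_cases i <;> fin_cases r <;> simp [Mmat, Matrix.col, Pi.single_apply]
  rw [eq_top_iff]
  intro v _
  rw [pi_eq_sum_univ' v]
  refine Submodule.sum_mem _ fun i _ => Submodule.smul_mem _ _ (Submodule.subset_span ?_)
  obtain ⟨a, j, h⟩ := key i
  refine ⟨Pi.single a 1, j, ?_⟩
  rw [← h]
end
end
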